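/- arXiv:0704.2007 — 2 statements merged into one kernel-verified Lean document; each statement's English description precedes it below -/
import Mathlib

section
/- Let (R, m) be a complete n-dimensional Gorenstein local ring and I ⊂ R an ideal with c = height I and d = dim R/I. If the variety V(I_d) is connected in codimension one, then B = Hom_R(H^c_I(R), H^c_I(R)) is a quasi-local ring (a commutative ring with a unique maximal ideal). -/
open CategoryTheory CategoryTheory.Limits Opposite IsLocalRing

noncomputable section

universe u

/-- The `i`-th local cohomology of the `R`-module `M` with support in the ideal `J`,
defined (following Mathlib) as the direct limit of `Ext^i(R/J^α, M)`. -/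
abbrev LC (R : Type u) [CommRing R] (J : Ideal R) (i : ℕ) (M : ModuleCat.{u} R) :
    ModuleCat.{u} R :=
  (localCohomology J i).obj M

/-- `Ext^i_R(M, N)` as an `R`-module. -/
abbrev ExtM (R : Type u) [CommRing R] (i : ℕ) (M N : ModuleCat.{u} R) : ModuleCat.{u} R :=
  ((Ext R (ModuleCat.{u} R) i).obj (op M)).obj N

/-- The height of an ideal: the infimum of the heights of the primes containing it. -/
def idealHeight (R : Type u) [CommRing R] (I : Ideal R) : ℕ∞ :=
  ⨅ p : {p : PrimeSpectrum R // I ≤ p.asIdeal}, Order.height (p : PrimeSpectrum R)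

/-- A Noetherian local ring `(R, 𝔪, k)` is Gorenstein if `Ext^i_R(k, R)` vanishes for
`i ≠ dim R` and is isomorphic to `k` in degree `dim R`. -/
def IsGorensteinLocalRing (R : Type u) [CommRing R] [IsLocalRing R] : Prop :=
  IsNoetherianRing R ∧
    ∃ n : ℕ, ringKrullDim R = n ∧
      (∀ i : ℕ, i ≠ n →
        Subsingleton (ExtM R i (ModuleCat.of R (R ⧸ maximalIdeal R)) (ModuleCat.of R R))) ∧
      Nonempty ((ExtM R n (ModuleCat.of R (R ⧸ maximalIdeal R)) (ModuleCat.of R R)) ≃ₗ[R]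
        (R ⧸ maximalIdeal R))

/-- The multiplicative set `S = ∩ (R \ p)`, `p` running through the
highest-dimensional (minimal) primes of `I`. -/
def asshCompl (R : Type u) [CommRing R] (I : Ideal R) : Submonoid R where
  carrier := {r | ∀ p ∈ I.minimalPrimes,
    ringKrullDim (R ⧸ p) = ringKrullDim (R ⧸ I) → r ∉ p}
  one_mem' := by
    intro p hp _
    have hprime : p.IsPrime := hp.1.1
    simpa using hprime.ne_top ∘ (Ideal.eq_top_iff_one p).mpr
  mul_mem' := by
    intro a b ha hb p hp hdim hab
    have hprime : p.IsPrime := hp.1.1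
    rcases hprime.mem_or_mem hab with h | h
    · exact ha p hp hdim h
    · exact hb p hp hdim h

/-- `I_d`: the intersection of the highest-dimensional primary components of `I`,
realized as `I R_S ∩ R` where `S` is the complement of the union of the
highest-dimensional minimal primes of `I`. -/
def highestDimPart (R : Type u) [CommRing R] (I : Ideal R) : Ideal R :=
  (I.map (algebraMap R (Localization (asshCompl R I)))).comap
    (algebraMap R (Localization (asshCompl R I)))

/-- `V(J)` is connected in codimension one: the graph whose vertices are the
highest-dimensional minimal primes of `J`, two of them joined by an edge iff
`dim R/(p + q) = dim R/J - 1`, is connected. -/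
def ConnectedInCodimensionOne (R : Type u) [CommRing R] (J : Ideal R) : Prop :=
  (SimpleGraph.fromRel
    (fun p q : {p : Ideal R // p ∈ J.minimalPrimes ∧
        ringKrullDim (R ⧸ p) = ringKrullDim (R ⧸ J)} =>
      ringKrullDim (R ⧸ (p.1 ⊔ q.1)) + 1 = ringKrullDim (R ⧸ J))).Connected

universe v

section LenAt

variable {R : Type*} [CommRing R] (q : PrimeSpectrum R)

/-- The length of the localization of `N` at the prime `q`. -/
def lenAt (N : Type*) [AddCommGroup N] [Module R N] : ℕ∞ :=
  Module.length (Localization.AtPrime q.asIdeal) (LocalizedModule q.asIdeal.primeCompl N)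

variable {N N₁ N₂ N₃ : Type*} [AddCommGroup N] [Module R N] [AddCommGroup N₁] [Module R N₁]
  [AddCommGroup N₂] [Module R N₂] [AddCommGroup N₃] [Module R N₃]

theorem lenAt_eq_zero_iff : lenAt q N = 0 ↔ ∀ x : N, ∃ s ∉ q.asIdeal, s • x = 0 := by
  rw [lenAt, Module.length_eq_zero_iff, LocalizedModule.subsingleton_iff]
  rfl

theorem lenAt_ne_zero_iff_mem_support : lenAt q N ≠ 0 ↔ q ∈ Module.support R N := by
  rw [Module.mem_support_iff, lenAt, Ne, Module.length_eq_zero_iff, not_subsingleton_iff_nontrivial]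

theorem lenAt_le_of_injective (f : N₁ →ₗ[R] N₂) (hf : Function.Injective f) :
    lenAt q N₁ ≤ lenAt q N₂ :=
  Module.length_le_of_injective (LocalizedModule.map q.asIdeal.primeCompl f)
    (LocalizedModule.map_injective _ f hf)

theorem lenAt_le_of_surjective (f : N₁ →ₗ[R] N₂) (hf : Function.Surjective f) :
    lenAt q N₂ ≤ lenAt q N₁ :=
  Module.length_le_of_surjective (LocalizedModule.map q.asIdeal.primeCompl f)
    (LocalizedModule.map_surjective _ f hf)

theorem lenAt_congr (e : N₁ ≃ₗ[R] N₂) : lenAt q N₁ = lenAt q N₂ :=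
  le_antisymm (lenAt_le_of_injective q e.toLinearMap e.injective)
    (lenAt_le_of_surjective q e.toLinearMap e.surjective)

theorem lenAt_eq_add_of_exact (f : N₁ →ₗ[R] N₂) (g : N₂ →ₗ[R] N₃) (hf : Function.Injective f)
    (hg : Function.Surjective g) (hfg : Function.Exact f g) :
    lenAt q N₂ = lenAt q N₁ + lenAt q N₃ :=
  Module.length_eq_add_of_exact (LocalizedModule.map q.asIdeal.primeCompl f)
    (LocalizedModule.map q.asIdeal.primeCompl g) (LocalizedModule.map_injective _ f hf)
    (LocalizedModule.map_surjective _ g hg) (LocalizedModule.map_exact _ f g hfg)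

theorem lenAt_eq_submodule_add_quotient (P : Submodule R N) :
    lenAt q N = lenAt q P + lenAt q (N ⧸ P) :=
  lenAt_eq_add_of_exact q P.subtype P.mkQ P.injective_subtype P.mkQ_surjective
    (LinearMap.exact_subtype_mkQ _)

theorem lenAt_le_add_of_exact (f : N₁ →ₗ[R] N₂) (g : N₂ →ₗ[R] N₃) (hfg : Function.Exact f g) :
    lenAt q N₂ ≤ lenAt q N₁ + lenAt q N₃ := by
  rw [lenAt_eq_submodule_add_quotient q (LinearMap.range f)]
  refine add_le_add (lenAt_le_of_surjective q f.rangeRestrict f.surjective_rangeRestrict) ?_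
  rw [← LinearMap.exact_iff.mp hfg]
  exact lenAt_le_of_injective q ((LinearMap.ker g).liftQ g le_rfl)
    (LinearMap.ker_eq_bot.mp (Submodule.ker_liftQ_eq_bot _ _ _ le_rfl))

theorem lenAt_subsingleton [Subsingleton N] : lenAt q N = 0 :=
  (lenAt_eq_zero_iff q).mpr fun _ => ⟨1, q.isPrime.one_notMem, Subsingleton.elim _ _⟩

theorem lenAt_eq_zero_of_le {p : PrimeSpectrum R} (hpq : p ≤ q) (h : lenAt q N = 0) :
    lenAt p N = 0 := by
  rw [lenAt_eq_zero_iff] at h ⊢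
  intro x
  obtain ⟨s, hs, hx⟩ := h x
  exact ⟨s, fun hp => hs (hpq hp), hx⟩

theorem lenAt_quotient_eq_zero {J : Ideal R} (h : ¬ J ≤ q.asIdeal) : lenAt q (R ⧸ J) = 0 := by
  obtain ⟨s, hsJ, hsq⟩ := Set.not_subset.mp h
  refine (lenAt_eq_zero_iff q).mpr fun x => ⟨s, hsq, ?_⟩
  obtain ⟨x, rfl⟩ := Ideal.Quotient.mk_surjective x
  rw [Algebra.smul_def, Ideal.Quotient.algebraMap_eq, Ideal.Quotient.eq_zero_iff_mem.mpr hsJ,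
    zero_mul]

theorem lenAt_quotient_ne_zero {J : Ideal R} (h : J ≤ q.asIdeal) : lenAt q (R ⧸ J) ≠ 0 := by
  intro h0
  obtain ⟨s, hsq, hs⟩ := (lenAt_eq_zero_iff q).mp h0 1
  rw [Algebra.smul_def, mul_one, Ideal.Quotient.algebraMap_eq,
    Ideal.Quotient.eq_zero_iff_mem] at hs
  exact hsq (h hs)

theorem lenAt_residue_eq_one : lenAt q (R ⧸ q.asIdeal) = 1 := by
  have hne := lenAt_quotient_ne_zero q (J := q.asIdeal) le_rfl
  rw [lenAt, Module.length_eq_one_iff]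
  rw [lenAt, Ne, Module.length_eq_zero_iff, not_subsingleton_iff_nontrivial] at hne
  rw [isSimpleModule_iff_toSpanSingleton_surjective]
  refine ⟨hne, fun x hx y => ?_⟩
  induction x using LocalizedModule.induction_on with | _ a s
  induction y using LocalizedModule.induction_on with | _ b t
  obtain ⟨a, rfl⟩ := Ideal.Quotient.mk_surjective a
  obtain ⟨b, rfl⟩ := Ideal.Quotient.mk_surjective b
  have ha : a ∉ q.asIdeal := fun ha => hx (by
    rw [Ideal.Quotient.eq_zero_iff_mem.mpr ha, LocalizedModule.zero_mk])
  refine ⟨Localization.mk (b * s) (t * ⟨a, ha⟩), ?_⟩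
  rw [LinearMap.toSpanSingleton_apply, LocalizedModule.mk_smul_mk, LocalizedModule.mk_eq]
  refine ⟨1, ?_⟩
  simp only [one_smul, Submonoid.smul_def, Submonoid.coe_mul, Algebra.smul_def,
    Ideal.Quotient.algebraMap_eq, ← map_mul]
  congr 1
  ring

theorem lenAt_ne_top_of_support [IsNoetherianRing R] {N : Type v} [AddCommGroup N] [Module R N]
    [Module.Finite R N]
    (h : ∀ p ∈ Module.support R N, p ≤ q → p = q) : lenAt q N ≠ ⊤ := by
  induction ‹Module.Finite R N› using
    IsNoetherianRing.induction_on_isQuotientEquivQuotientPrime R with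
  | subsingleton N => simp [lenAt_subsingleton]
  | quotient N p f =>
    rw [lenAt_congr q f]
    by_cases hp : p ≤ q
    · have := h p (by
        rw [f.support_eq, ← lenAt_ne_zero_iff_mem_support]
        exact lenAt_quotient_ne_zero p le_rfl) hp
      subst this
      exact (lenAt_residue_eq_one p).trans_ne (by simp)
    · rw [lenAt_quotient_eq_zero q (J := p.1) hp]
      simp
  | exact N₁ N₂ N₃ f g hf hg hfg h₁ h₃ =>
    rw [lenAt_eq_add_of_exact q f g hf hg hfg]
    rw [Module.support_of_exact hfg hf hg] at h
    simp only [ne_eq, ENat.add_eq_top, not_or]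
    exact ⟨h₁ fun p hp => h p (Or.inl hp), h₃ fun p hp => h p (Or.inr hp)⟩

/-- Nakayama's lemma at a prime. -/
theorem lenAt_eq_zero_of_smul [Module.Finite R N] {x : R} (hx : x ∈ q.asIdeal)
    (h : ∀ y : N, ∃ s ∉ q.asIdeal, ∃ z : N, s • y = x • z) : lenAt q N = 0 := by
  rw [lenAt, Module.length_eq_zero_iff]
  have hfin : Module.Finite (Localization.AtPrime q.asIdeal)
      (LocalizedModule q.asIdeal.primeCompl N) :=
    Module.Finite.of_isLocalizedModule q.asIdeal.primeCompl
      (LocalizedModule.mkLinearMap q.asIdeal.primeCompl N)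
  rw [← Submodule.subsingleton_iff (Localization.AtPrime q.asIdeal)]
  refine subsingleton_of_bot_eq_top (Eq.symm ?_)
  refine Submodule.eq_bot_of_le_smul_of_le_jacobson_bot
    (IsLocalRing.maximalIdeal (Localization.AtPrime q.asIdeal)) ⊤ Module.Finite.fg_top ?_
    (IsLocalRing.maximalIdeal_le_jacobson _)
  rintro y -
  induction y using LocalizedModule.induction_on with | _ b t
  obtain ⟨s, hs, z, hz⟩ := h b
  have hxm : algebraMap R (Localization.AtPrime q.asIdeal) x ∈
      IsLocalRing.maximalIdeal (Localization.AtPrime q.asIdeal) :=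
    (IsLocalization.AtPrime.to_map_mem_maximal_iff _ q.asIdeal x).mpr hx
  have : LocalizedModule.mk b t = algebraMap R (Localization.AtPrime q.asIdeal) x •
      LocalizedModule.mk z (⟨s, hs⟩ * t) := by
    rw [algebraMap_smul, LocalizedModule.smul'_mk, ← hz]
    exact (LocalizedModule.mk_cancel_common_left ⟨s, hs⟩ t b).symm
  rw [this]
  exact Submodule.smul_mem_smul hxm trivial

end LenAt

section ExtR

/-- `Ext^i_R(N, R)`. -/
def ExtR (R : Type u) [CommRing R] (i : ℕ) (N : Type u) [AddCommGroup N] [Module R N] : Type u :=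
  Abelian.Ext (ModuleCat.of R N) (ModuleCat.of R R) i

variable {R : Type u} [CommRing R] (i : ℕ) {N N₁ N₂ N₃ : Type u} [AddCommGroup N] [Module R N]
  [AddCommGroup N₁] [Module R N₁] [AddCommGroup N₂] [Module R N₂] [AddCommGroup N₃] [Module R N₃]

instance : AddCommGroup (ExtR R i N) :=
  inferInstanceAs (AddCommGroup (Abelian.Ext (ModuleCat.of R N) (ModuleCat.of R R) i))

instance : Module R (ExtR R i N) :=
  inferInstanceAs (Module R (Abelian.Ext (ModuleCat.of R N) (ModuleCat.of R R) i))

instance [IsNoetherianRing R] [Module.Finite R N] : Module.Finite R (ExtR R i N) :=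
  ModuleCat.finite_ext R (ModuleCat.of R N) (ModuleCat.of R R) i

namespace ExtR

/-- The map `Ext^i(N₂, R) → Ext^i(N₁, R)` induced by `f : N₁ → N₂`. -/
def map (f : N₁ →ₗ[R] N₂) : ExtR R i N₂ →ₗ[R] ExtR R i N₁ :=
  (Abelian.Ext.mk₀ (ModuleCat.ofHom f)).precompOfLinear R (ModuleCat.of R R) (zero_add i)

theorem map_apply (f : N₁ →ₗ[R] N₂) (x : ExtR R i N₂) :
    map i f x = (Abelian.Ext.mk₀ (ModuleCat.ofHom f)).comp
      (show Abelian.Ext (ModuleCat.of R N₂) (ModuleCat.of R R) i from x) (zero_add i) := rfl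

@[simp]
theorem map_id (x : ExtR R i N) : map i (LinearMap.id : N →ₗ[R] N) x = x :=
  Abelian.Ext.mk₀_id_comp _

theorem map_comp (f : N₁ →ₗ[R] N₂) (g : N₂ →ₗ[R] N₃) (x : ExtR R i N₃) :
    map i (g ∘ₗ f) x = map i f (map i g x) :=
  (Abelian.Ext.mk₀_comp_mk₀_assoc (ModuleCat.ofHom f) (ModuleCat.ofHom g) _).symm

theorem map_add (f g : N₁ →ₗ[R] N₂) (x : ExtR R i N₂) :
    map i (f + g) x = map i f x + map i g x := by
  rw [map_apply, ModuleCat.ofHom_add, Abelian.Ext.mk₀_add, Abelian.Ext.add_comp]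
  rfl

theorem map_smul (r : R) (f : N₁ →ₗ[R] N₂) (x : ExtR R i N₂) :
    map i (r • f) x = r • map i f x := by
  have : ModuleCat.ofHom (r • f) = r • ModuleCat.ofHom f := rfl
  rw [map_apply, this, Abelian.Ext.mk₀_smul, Abelian.Ext.smul_comp]
  rfl

theorem map_zero (x : ExtR R i N₂) : map i (0 : N₁ →ₗ[R] N₂) x = 0 := by
  rw [← zero_smul R (0 : N₁ →ₗ[R] N₂), map_smul, zero_smul]

/-- `Ext^i(-, R)` applied to a linear equivalence. -/
def congr (e : N₁ ≃ₗ[R] N₂) : ExtR R i N₂ ≃ₗ[R] ExtR R i N₁ :=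
  LinearEquiv.ofLinearMap (map i e.toLinearMap) (map i e.symm.toLinearMap)
    (by ext x; simp [← map_comp]) (by ext x; simp [← map_comp])

theorem subsingleton_of_subsingleton [Subsingleton N] : Subsingleton (ExtR R i N) :=
  ⟨fun x y => by
    have h : (LinearMap.id : N →ₗ[R] N) = 0 := Subsingleton.elim _ _
    rw [← map_id i x, ← map_id i y, h, map_zero, map_zero]⟩

theorem smul_eq_zero_of_annihilates {r : R} (h : ∀ x : N, r • x = 0) (ξ : ExtR R i N) :
    r • ξ = 0 := by
  have : r • (LinearMap.id : N →ₗ[R] N) = 0 := LinearMap.ext h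
  rw [← map_id i ξ, ← map_smul, this, map_zero]

section LES

variable {f : N₁ →ₗ[R] N₂} {g : N₂ →ₗ[R] N₃} (hf : Function.Injective f)
  (hg : Function.Surjective g) (hfg : Function.Exact f g)

include hf hg hfg

theorem shortExact_mk :
    (ShortComplex.mk (ModuleCat.ofHom f) (ModuleCat.ofHom g)
      (by ext x; exact hfg.apply_apply_eq_zero x)).ShortExact where
  exact := (ShortComplex.ShortExact.moduleCat_exact_iff_function_exact _).mpr hfg
  mono_f := (ModuleCat.mono_iff_injective _).mpr hf
  epi_g := (ModuleCat.epi_iff_surjective _).mpr hg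

theorem exact_map : Function.Exact (map i g) (map i f) := by
  intro x
  constructor
  · exact Abelian.Ext.contravariant_sequence_exact₂ (shortExact_mk hf hg hfg) (ModuleCat.of R R) x
  · rintro ⟨y, rfl⟩
    rw [← map_comp, hfg.linearMap_comp_eq_zero, map_zero]

theorem exists_delta : ∃ δ : ExtR R i N₁ →ₗ[R] ExtR R (i + 1) N₃,
    Function.Exact (map i f) δ ∧ Function.Exact δ (map (i + 1) g) := by
  have hS := shortExact_mk hf hg hfg
  refine ⟨hS.extClass.precompOfLinear R (ModuleCat.of R R) (add_comm 1 i), ?_, ?_⟩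
  · intro x
    constructor
    · exact Abelian.Ext.contravariant_sequence_exact₁ hS (ModuleCat.of R R) x (add_comm 1 i)
    · rintro ⟨y, rfl⟩
      exact hS.extClass_comp_assoc (h := add_comm 1 i) _
  · intro x
    constructor
    · intro hx
      exact Abelian.Ext.contravariant_sequence_exact₃ hS (ModuleCat.of R R) x hx (add_comm 1 i)
    · rintro ⟨y, rfl⟩
      exact hS.comp_extClass_assoc _ (add_comm 1 i)

end LES

theorem map_zero_injective {g : N₂ →ₗ[R] N₃} (hg : Function.Surjective g) :
    Function.Injective (map 0 g) := by
  have : Epi (ModuleCat.ofHom g) := (ModuleCat.epi_iff_surjective _).mpr hg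
  exact Abelian.Ext.precomp_mk₀_injective_of_epi (ModuleCat.of R R) (ModuleCat.ofHom g)

/-- `Ext^0(N, R) = Hom(N, R)`. -/
def zeroEquiv : ExtR R 0 N ≃ₗ[R] (N →ₗ[R] R) :=
  (Abelian.Ext.linearEquiv₀ (R := R) (X := ModuleCat.of R N) (Y := ModuleCat.of R R)).trans
    ModuleCat.homLinearEquiv

end ExtR

end ExtR

section ExtLength

variable {R : Type u} [CommRing R]

/-- The quotient `N / xN`. -/
abbrev QuotX (x : R) (N : Type*) [AddCommGroup N] [Module R N] :=
  N ⧸ LinearMap.range (LinearMap.lsmul R N x)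

theorem mem_of_mem_support {N : Type*} [AddCommGroup N] [Module R N] {p : PrimeSpectrum R}
    (hp : p ∈ Module.support R N) {a : R} (ha : ∀ y : N, a • y = 0) : a ∈ p.asIdeal :=
  Module.annihilator_le_of_mem_support hp (Module.mem_annihilator.mpr ha)

theorem smul_quotX_eq_zero {N : Type*} [AddCommGroup N] [Module R N] (x : R) (y : QuotX x N) :
    x • y = 0 := by
  obtain ⟨y, rfl⟩ := Submodule.mkQ_surjective _ y
  rw [← map_smul, Submodule.mkQ_apply, Submodule.Quotient.mk_eq_zero]
  exact ⟨y, rfl⟩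

theorem smul_quotient_eq_zero {J : Ideal R} {a : R} (ha : a ∈ J) (y : R ⧸ J) : a • y = 0 := by
  obtain ⟨y, rfl⟩ := Ideal.Quotient.mk_surjective y
  rw [Algebra.smul_def, Ideal.Quotient.algebraMap_eq, Ideal.Quotient.eq_zero_iff_mem.mpr ha,
    zero_mul]

theorem smul_injective_quotient_prime (p : PrimeSpectrum R) {x : R} (hx : x ∉ p.asIdeal) :
    Function.Injective (LinearMap.lsmul R (R ⧸ p.asIdeal) x) := by
  rw [injective_iff_map_eq_zero]
  intro y hy
  obtain ⟨y, rfl⟩ := Ideal.Quotient.mk_surjective y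
  rw [LinearMap.lsmul_apply, Algebra.smul_def, Ideal.Quotient.algebraMap_eq, ← map_mul,
    Ideal.Quotient.eq_zero_iff_mem] at hy
  exact Ideal.Quotient.eq_zero_iff_mem.mpr ((p.isPrime.mem_or_mem hy).resolve_left hx)

theorem lt_of_mem_support_quotX {p r : PrimeSpectrum R} {x : R} (hx : x ∉ p.asIdeal)
    (hr : r ∈ Module.support R (QuotX x (R ⧸ p.asIdeal))) : p < r := by
  refine lt_of_le_of_ne (fun a ha => mem_of_mem_support hr fun y => ?_) ?_
  · obtain ⟨y, rfl⟩ := Submodule.mkQ_surjective _ y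
    rw [← map_smul, smul_quotient_eq_zero ha, map_zero]
  · rintro rfl
    exact hx (mem_of_mem_support hr (smul_quotX_eq_zero x))

theorem eq_of_mem_support_quotX {p q r : PrimeSpectrum R} (hpq : p ⋖ q) {x : R}
    (hx : x ∉ p.asIdeal) (hr : r ∈ Module.support R (QuotX x (R ⧸ p.asIdeal))) (hrq : r ≤ q) :
    r = q :=
  hrq.eq_of_not_lt fun h => hpq.2 (lt_of_mem_support_quotX hx hr) h

theorem lenAt_quotX_prime_ne_zero {p q : PrimeSpectrum R} (hpq : p ≤ q) {x : R}
    (hx : x ∈ q.asIdeal) : lenAt q (QuotX x (R ⧸ p.asIdeal)) ≠ 0 := by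
  let π : (R ⧸ p.asIdeal) →ₗ[R] (R ⧸ q.asIdeal) := Submodule.mapQ _ _ LinearMap.id hpq
  have hπ : Function.Surjective π := by
    intro y
    obtain ⟨y, rfl⟩ := Submodule.mkQ_surjective _ y
    exact ⟨Submodule.mkQ _ y, rfl⟩
  let f : QuotX x (R ⧸ p.asIdeal) →ₗ[R] (R ⧸ q.asIdeal) := Submodule.liftQ _ π (by
    rintro _ ⟨y, rfl⟩
    rw [LinearMap.mem_ker, LinearMap.lsmul_apply, map_smul, smul_quotient_eq_zero hx])
  have hf : Function.Surjective f := fun y => by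
    obtain ⟨z, rfl⟩ := hπ y
    exact ⟨Submodule.mkQ _ z, rfl⟩
  have h := lenAt_le_of_surjective q f hf
  rw [lenAt_residue_eq_one] at h
  intro h0
  simp [h0] at h

variable (q : PrimeSpectrum R)

theorem lenAt_eq_add_of_exact_five {A B C D E : Type*} [AddCommGroup A] [Module R A]
    [AddCommGroup B] [Module R B] [AddCommGroup C] [Module R C] [AddCommGroup D] [Module R D]
    [AddCommGroup E] [Module R E] (f : A →ₗ[R] B) (g : B →ₗ[R] C) (h : C →ₗ[R] D)
    (k : D →ₗ[R] E) (hA : lenAt q A = 0) (hE : lenAt q E = 0) (hfg : Function.Exact f g)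
    (hgh : Function.Exact g h) (hhk : Function.Exact h k) :
    lenAt q C = lenAt q B + lenAt q D := by
  have h1 : lenAt q (LinearMap.range f) = 0 :=
    le_antisymm (hA ▸ lenAt_le_of_surjective q f.rangeRestrict f.surjective_rangeRestrict) bot_le
  have h2 : lenAt q (LinearMap.range k) = 0 :=
    le_antisymm (hE ▸ lenAt_le_of_injective q (LinearMap.range k).subtype
      (Submodule.injective_subtype _)) bot_le
  rw [lenAt_eq_submodule_add_quotient q (LinearMap.ker g),
    lenAt_congr q g.quotKerEquivRange, hfg.linearMap_ker_eq, h1, zero_add,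
    lenAt_eq_submodule_add_quotient q (N := D) (LinearMap.ker k),
    lenAt_congr q k.quotKerEquivRange, h2, add_zero, hhk.linearMap_ker_eq,
    ← lenAt_congr q h.quotKerEquivRange, ← hgh.linearMap_ker_eq]
  exact lenAt_eq_submodule_add_quotient q _

theorem lenAt_add_add_eq_of_exact {A B C D E F : Type*} [AddCommGroup A] [Module R A]
    [AddCommGroup B] [Module R B] [AddCommGroup C] [Module R C] [AddCommGroup D] [Module R D]
    [AddCommGroup E] [Module R E] [AddCommGroup F] [Module R F]
    (f : A →ₗ[R] B) (g : B →ₗ[R] C) (h : C →ₗ[R] D) (k : D →ₗ[R] E) (l : E →ₗ[R] F)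
    (hf : Function.Injective f) (hl : Function.Surjective l) (hfg : Function.Exact f g)
    (hgh : Function.Exact g h) (hhk : Function.Exact h k) (hkl : Function.Exact k l) :
    lenAt q A + lenAt q C + lenAt q E = lenAt q B + lenAt q D + lenAt q F := by
  have hB : lenAt q B = lenAt q A + lenAt q (LinearMap.range g) := by
    rw [lenAt_eq_submodule_add_quotient q (LinearMap.ker g), lenAt_congr q g.quotKerEquivRange,
      hfg.linearMap_ker_eq, lenAt_congr q (LinearEquiv.ofInjective f hf)]
  have hC : lenAt q C = lenAt q (LinearMap.range g) + lenAt q (LinearMap.range h) := by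
    rw [lenAt_eq_submodule_add_quotient q (LinearMap.ker h), lenAt_congr q h.quotKerEquivRange,
      hgh.linearMap_ker_eq]
  have hD : lenAt q D = lenAt q (LinearMap.range h) + lenAt q (LinearMap.range k) := by
    rw [lenAt_eq_submodule_add_quotient q (LinearMap.ker k), lenAt_congr q k.quotKerEquivRange,
      hhk.linearMap_ker_eq]
  have hE : lenAt q E = lenAt q (LinearMap.range k) + lenAt q F := by
    rw [lenAt_eq_submodule_add_quotient q (LinearMap.ker l),
      lenAt_congr q (l.quotKerEquivOfSurjective hl), hkl.linearMap_ker_eq]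
  rw [hB, hC, hD, hE]
  abel

variable [IsNoetherianRing R] (i : ℕ)

omit [IsNoetherianRing R] in
theorem lenAt_ext_eq_zero_of_not_le {N : Type u} [AddCommGroup N] [Module R N] {a : R}
    (ha : ∀ y : N, a • y = 0) (haq : a ∉ q.asIdeal) : lenAt q (ExtR R i N) = 0 :=
  (lenAt_eq_zero_iff q).mpr fun ξ => ⟨a, haq, ExtR.smul_eq_zero_of_annihilates i ha ξ⟩

omit [IsNoetherianRing R] in
theorem lenAt_ext_quotient_eq_zero {J : Ideal R} (hJ : ¬ J ≤ q.asIdeal) :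
    lenAt q (ExtR R i (R ⧸ J)) = 0 := by
  obtain ⟨a, haJ, haq⟩ := Set.not_subset.mp hJ
  exact lenAt_ext_eq_zero_of_not_le q i (smul_quotient_eq_zero haJ) haq

theorem lenAt_ext_eq_zero_of_support {N : Type u} [AddCommGroup N] [Module R N]
    [Module.Finite R N] (h : ∀ p ∈ Module.support R N, p ≤ q →
      lenAt q (ExtR R i (R ⧸ p.asIdeal)) = 0) : lenAt q (ExtR R i N) = 0 := by
  induction ‹Module.Finite R N› using
    IsNoetherianRing.induction_on_isQuotientEquivQuotientPrime R with
  | subsingleton N =>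
    have := ExtR.subsingleton_of_subsingleton (R := R) i (N := N)
    exact lenAt_subsingleton q
  | quotient N p f =>
    rw [← lenAt_congr q (ExtR.congr i f)]
    by_cases hp : p ≤ q
    · refine h p ?_ hp
      rw [f.support_eq, ← lenAt_ne_zero_iff_mem_support]
      exact lenAt_quotient_ne_zero p le_rfl
    · exact lenAt_ext_quotient_eq_zero q i (J := p.1) hp
  | exact N₁ N₂ N₃ f g hf hg hfg h₁ h₃ =>
    rw [Module.support_of_exact hfg hf hg] at h
    have := lenAt_le_add_of_exact q _ _ (ExtR.exact_map i hf hg hfg)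
    rw [h₁ fun p hp => h p (Or.inl hp), h₃ fun p hp => h p (Or.inr hp)] at this
    simpa using this

theorem lenAt_ext_le {N : Type u} [AddCommGroup N] [Module R N]
    [Module.Finite R N] (h : ∀ p ∈ Module.support R N, p ≤ q → p = q) :
    lenAt q (ExtR R i N) ≤ lenAt q N * lenAt q (ExtR R i (R ⧸ q.asIdeal)) := by
  induction ‹Module.Finite R N› using
    IsNoetherianRing.induction_on_isQuotientEquivQuotientPrime R with
  | subsingleton N =>
    have := ExtR.subsingleton_of_subsingleton (R := R) i (N := N)
    simp [lenAt_subsingleton q]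
  | quotient N p f =>
    rw [← lenAt_congr q (ExtR.congr i f), lenAt_congr q f]
    by_cases hp : p ≤ q
    · have := h p (by
        rw [f.support_eq, ← lenAt_ne_zero_iff_mem_support]
        exact lenAt_quotient_ne_zero p le_rfl) hp
      subst this
      exact ((congrArg (· * _) (lenAt_residue_eq_one p)).trans (one_mul _)).ge
    · exact (lenAt_ext_quotient_eq_zero q i (J := p.1) hp).le.trans bot_le
  | exact N₁ N₂ N₃ f g hf hg hfg h₁ h₃ =>
    rw [Module.support_of_exact hfg hf hg] at h
    refine (lenAt_le_add_of_exact q _ _ (ExtR.exact_map i hf hg hfg)).trans ?_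
    rw [lenAt_eq_add_of_exact q f g hf hg hfg, add_comm, add_mul]
    exact add_le_add (h₁ fun p hp => h p (Or.inl hp)) (h₃ fun p hp => h p (Or.inr hp))

theorem lenAt_ext_eq {N : Type u} [AddCommGroup N] [Module R N]
    [Module.Finite R N] (h : ∀ p ∈ Module.support R N, p ≤ q → p = q)
    (h0 : ∀ j, j ≠ i → lenAt q (ExtR R j (R ⧸ q.asIdeal)) = 0) :
    lenAt q (ExtR R i N) = lenAt q N * lenAt q (ExtR R i (R ⧸ q.asIdeal)) := by
  have key (j : ℕ) (hj : j ≠ i) {N : Type u} [AddCommGroup N] [Module R N]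
      [Module.Finite R N] (h : ∀ p ∈ Module.support R N, p ≤ q → p = q) :
      lenAt q (ExtR R j N) = 0 :=
    le_antisymm ((lenAt_ext_le q j h).trans (by simp [h0 j hj])) bot_le
  induction ‹Module.Finite R N› using
    IsNoetherianRing.induction_on_isQuotientEquivQuotientPrime R with
  | subsingleton N =>
    have := ExtR.subsingleton_of_subsingleton (R := R) i (N := N)
    simp [lenAt_subsingleton q]
  | quotient N p f =>
    rw [← lenAt_congr q (ExtR.congr i f), lenAt_congr q f]
    by_cases hp : p ≤ q
    · have := h p (by
        rw [f.support_eq, ← lenAt_ne_zero_iff_mem_support]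
        exact lenAt_quotient_ne_zero p le_rfl) hp
      subst this
      exact ((congrArg (· * _) (lenAt_residue_eq_one p)).trans (one_mul _)).symm
    · rw [lenAt_ext_quotient_eq_zero q i (J := p.1) hp, lenAt_quotient_eq_zero q (J := p.1) hp,
        zero_mul]
  | exact N₁ N₂ N₃ f g hf hg hfg h₁ h₃ =>
    rw [Module.support_of_exact hfg hf hg] at h
    rw [lenAt_eq_add_of_exact q f g hf hg hfg, add_mul, ← h₁ fun p hp => h p (Or.inl hp),
      ← h₃ fun p hp => h p (Or.inr hp), add_comm]
    obtain ⟨δ, hδ, hδ'⟩ := ExtR.exists_delta i hf hg hfg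
    have hlast : lenAt q (ExtR R (i + 1) N₃) = 0 :=
      key (i + 1) (by simp) fun p hp => h p (Or.inr hp)
    cases i with
    | zero =>
      refine lenAt_eq_add_of_exact_five q (0 : PUnit.{1} →ₗ[R] _) _ _ δ (lenAt_subsingleton q)
        hlast ?_ (ExtR.exact_map 0 hf hg hfg) hδ
      exact (LinearMap.exact_zero_iff_injective _ _).mpr (ExtR.map_zero_injective hg)
    | succ j =>
      obtain ⟨ε, hε, hε'⟩ := ExtR.exists_delta j hf hg hfg
      exact lenAt_eq_add_of_exact_five q ε _ _ δ
        (key j (by simp) fun p hp => h p (Or.inl hp)) hlast hε'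
        (ExtR.exact_map (j + 1) hf hg hfg) hδ

omit [IsNoetherianRing R] in
theorem map_lsmul {N : Type u} [AddCommGroup N] [Module R N] (x : R) (ξ : ExtR R i N) :
    ExtR.map i (LinearMap.lsmul R N x) ξ = x • ξ := by
  have : LinearMap.lsmul R N x = x • LinearMap.id := rfl
  rw [this, ExtR.map_smul, ExtR.map_id]

omit [IsNoetherianRing R] in
theorem exists_quotX_ext_injective {N : Type u} [AddCommGroup N] [Module R N] {x : R}
    (hx : Function.Injective (LinearMap.lsmul R N x)) :
    ∃ δ : QuotX x (ExtR R i N) →ₗ[R] ExtR R (i + 1) (QuotX x N), Function.Injective δ := by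
  obtain ⟨δ, hδ, -⟩ := ExtR.exists_delta i hx (Submodule.mkQ_surjective _)
    (LinearMap.exact_map_mkQ_range _)
  have hmap : ExtR.map i (LinearMap.lsmul R N x) = LinearMap.lsmul R (ExtR R i N) x :=
    LinearMap.ext fun ξ => map_lsmul i x ξ
  rw [hmap] at hδ
  refine ⟨Submodule.liftQ _ δ hδ.linearMap_ker_eq.ge, ?_⟩
  exact LinearMap.ker_eq_bot.mp (Submodule.ker_liftQ_eq_bot _ _ _ hδ.linearMap_ker_eq.le)

theorem lenAt_ext_eq_zero_of_quotX {N : Type u} [AddCommGroup N] [Module R N]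
    [Module.Finite R N] {x : R} (hxq : x ∈ q.asIdeal)
    (hx : Function.Injective (LinearMap.lsmul R N x))
    (h : lenAt q (ExtR R (i + 1) (QuotX x N)) = 0) : lenAt q (ExtR R i N) = 0 := by
  obtain ⟨δ, hδ⟩ := exists_quotX_ext_injective i hx
  have h1 : lenAt q (QuotX x (ExtR R i N)) = 0 :=
    le_antisymm ((lenAt_le_of_injective q δ hδ).trans h.le) bot_le
  refine lenAt_eq_zero_of_smul q hxq fun y => ?_
  obtain ⟨s, hs, hsy⟩ := (lenAt_eq_zero_iff q).mp h1 (Submodule.mkQ _ y)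
  rw [← map_smul, Submodule.mkQ_apply, Submodule.Quotient.mk_eq_zero] at hsy
  obtain ⟨z, hz⟩ := hsy
  exact ⟨s, hs, z, hz.symm⟩

theorem lenAt_ext_succ_ne_zero_of_covBy {p q : PrimeSpectrum R} (hpq : p ⋖ q)
    (h : lenAt p (ExtR R i (R ⧸ p.asIdeal)) ≠ 0) :
    lenAt q (ExtR R (i + 1) (R ⧸ q.asIdeal)) ≠ 0 := by
  obtain ⟨x, hxq, hxp⟩ := Set.not_subset.mp hpq.lt.not_ge
  intro h0
  refine h (lenAt_eq_zero_of_le q hpq.le (lenAt_ext_eq_zero_of_quotX q i hxq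
    (smul_injective_quotient_prime p hxp) (le_antisymm ?_ bot_le)))
  refine (lenAt_ext_le q (i + 1) fun r hr hrq => eq_of_mem_support_quotX hpq hxp hr hrq).trans ?_
  rw [h0, mul_zero]

end ExtLength

section Herbrand

variable {R : Type u} [CommRing R] (q : PrimeSpectrum R)

/-- The map induced on `x`-torsion. -/
def kerSMulMap (x : R) {M N : Type*} [AddCommGroup M] [Module R M] [AddCommGroup N] [Module R N]
    (f : M →ₗ[R] N) :
    LinearMap.ker (LinearMap.lsmul R M x) →ₗ[R] LinearMap.ker (LinearMap.lsmul R N x) :=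
  f.restrict fun y (hy : x • y = 0) => show x • f y = 0 by rw [← map_smul, hy, map_zero]

theorem exact_kerSMulMap (x : R) {M₁ M₂ M₃ : Type*} [AddCommGroup M₁] [Module R M₁]
    [AddCommGroup M₂] [Module R M₂] [AddCommGroup M₃] [Module R M₃] {f : M₁ →ₗ[R] M₂}
    {g : M₂ →ₗ[R] M₃} (hf : Function.Injective f) (hfg : Function.Exact f g) :
    Function.Exact (kerSMulMap x f) (kerSMulMap x g) := by
  intro y
  constructor
  · intro hy
    obtain ⟨z, hz⟩ := (hfg y.1).mp (congrArg Subtype.val hy)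
    refine ⟨⟨z, hf ?_⟩, Subtype.ext hz⟩
    rw [LinearMap.lsmul_apply, map_smul, hz, map_zero]
    exact y.2
  · rintro ⟨z, rfl⟩
    exact Subtype.ext (hfg.apply_apply_eq_zero z.1)

theorem lenAt_herbrand (x : R) {M₁ M₂ M₃ : Type*} [AddCommGroup M₁] [Module R M₁]
    [AddCommGroup M₂] [Module R M₂] [AddCommGroup M₃] [Module R M₃] {f : M₁ →ₗ[R] M₂}
    {g : M₂ →ₗ[R] M₃} (hf : Function.Injective f) (hg : Function.Surjective g)
    (hfg : Function.Exact f g) :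
    lenAt q (LinearMap.ker (LinearMap.lsmul R M₁ x)) +
      lenAt q (LinearMap.ker (LinearMap.lsmul R M₃ x)) + lenAt q (QuotX x M₂) =
    lenAt q (LinearMap.ker (LinearMap.lsmul R M₂ x)) + lenAt q (QuotX x M₁) +
      lenAt q (QuotX x M₃) := by
  have h₁ : f.comp (LinearMap.lsmul R M₁ x) = (LinearMap.lsmul R M₂ x).comp f := by
    ext; simp
  have h₂ : g.comp (LinearMap.lsmul R M₂ x) = (LinearMap.lsmul R M₃ x).comp g := by
    ext; simp
  let G₁ : QuotX x M₁ →ₗ[R] QuotX x M₂ := Submodule.mapQ _ _ f (by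
    rintro _ ⟨y, rfl⟩
    exact ⟨f y, (map_smul f x y).symm⟩)
  let G₂ : QuotX x M₂ →ₗ[R] QuotX x M₃ := Submodule.mapQ _ _ g (by
    rintro _ ⟨y, rfl⟩
    exact ⟨g y, (map_smul g x y).symm⟩)
  have hι₂ := LinearMap.exact_subtype_ker_map (LinearMap.lsmul R M₂ x)
  have hι₃ := LinearMap.exact_subtype_ker_map (LinearMap.lsmul R M₃ x)
  have hπ₁ := LinearMap.exact_map_mkQ_range (LinearMap.lsmul R M₁ x)
  have hπ₂ := LinearMap.exact_map_mkQ_range (LinearMap.lsmul R M₂ x)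
  refine lenAt_add_add_eq_of_exact q (kerSMulMap x f) (kerSMulMap x g)
    (SnakeLemma.δ' _ _ _ f g hfg f g hfg h₁ h₂ _ hι₃ _ hπ₁ hg hf) G₁ G₂ ?_ ?_
    (exact_kerSMulMap x hf hfg)
    (SnakeLemma.exact_δ'_right _ _ _ f g hfg f g hfg h₁ h₂ _ hι₂ _ hι₃ _ hπ₁ hg hf (kerSMulMap x g) rfl
      (Submodule.injective_subtype _))
    (SnakeLemma.exact_δ'_left _ _ _ f g hfg f g hfg h₁ h₂ _ hι₃ _ hπ₁ _ hπ₂ hg hf G₁ rfl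
      (Submodule.mkQ_surjective _)) ?_
  · exact fun a b hab => Subtype.ext (hf (congrArg Subtype.val hab))
  · intro y
    obtain ⟨y, rfl⟩ := Submodule.mkQ_surjective _ y
    obtain ⟨z, rfl⟩ := hg y
    exact ⟨Submodule.mkQ _ z, rfl⟩
  · intro y
    constructor
    · obtain ⟨y, rfl⟩ := Submodule.mkQ_surjective _ y
      intro hy
      obtain ⟨w, hw⟩ := (Submodule.Quotient.mk_eq_zero _).mp
        (show Submodule.Quotient.mk (g y) = (0 : QuotX x M₃) from hy)
      obtain ⟨w, rfl⟩ := hg w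
      have : g (y - x • w) = 0 := by
        rw [map_sub, map_smul, sub_eq_zero]
        exact hw.symm
      obtain ⟨z, hz⟩ := (hfg _).mp this
      refine ⟨Submodule.mkQ _ z, ?_⟩
      change Submodule.mkQ _ (f z) = Submodule.mkQ _ y
      rw [hz, map_sub, sub_eq_self, Submodule.mkQ_apply, Submodule.Quotient.mk_eq_zero]
      exact ⟨w, rfl⟩
    · rintro ⟨z, rfl⟩
      obtain ⟨z, rfl⟩ := Submodule.mkQ_surjective _ z
      change Submodule.mkQ _ (g (f z)) = 0
      rw [hfg.apply_apply_eq_zero, map_zero]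

theorem lenAt_quotX_congr (x : R) {M N : Type*} [AddCommGroup M] [Module R M] [AddCommGroup N]
    [Module R N] (e : M ≃ₗ[R] N) : lenAt q (QuotX x M) = lenAt q (QuotX x N) := by
  refine lenAt_congr q (Submodule.Quotient.equiv _ _ e (le_antisymm ?_ ?_))
  · rintro _ ⟨_, ⟨y, rfl⟩, rfl⟩
    exact ⟨e y, (map_smul e x y).symm⟩
  · rintro _ ⟨y, rfl⟩
    exact ⟨x • e.symm y, ⟨_, rfl⟩, by simp⟩

variable [IsNoetherianRing R]

theorem lenAt_ker_and_quotX {p q : PrimeSpectrum R} (hpq : p ⋖ q) {x : R} (hxq : x ∈ q.asIdeal)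
    (hxp : x ∉ p.asIdeal) {M : Type u} [AddCommGroup M] [Module R M] [Module.Finite R M]
    (hM : ∀ r ∈ Module.support R M, p ≤ r) :
    lenAt q (LinearMap.ker (LinearMap.lsmul R M x)) ≠ ⊤ ∧
    lenAt q (QuotX x M) = lenAt q (LinearMap.ker (LinearMap.lsmul R M x)) +
      lenAt q (QuotX x (R ⧸ p.asIdeal)) * lenAt p M := by
  induction ‹Module.Finite R M› using
    IsNoetherianRing.induction_on_isQuotientEquivQuotientPrime R with
  | subsingleton N => simp [lenAt_subsingleton]
  | quotient N r f =>
    have hpr : p ≤ r := hM r (by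
      rw [f.support_eq, ← lenAt_ne_zero_iff_mem_support]
      exact lenAt_quotient_ne_zero r le_rfl)
    rcases hpr.eq_or_lt with rfl | hlt
    · have hinj : Function.Injective (LinearMap.lsmul R N x) := fun a b hab => f.injective
        (smul_injective_quotient_prime p hxp (by simpa using congrArg f hab))
      rw [LinearMap.ker_eq_bot.mpr hinj, lenAt_subsingleton, lenAt_quotX_congr q x f,
        lenAt_congr p f, (lenAt_residue_eq_one p : lenAt p (R ⧸ p.1) = 1), zero_add, mul_one]
      exact ⟨by simp, rfl⟩
    · rw [lenAt_congr p f, lenAt_quotient_eq_zero p (J := r.1) hlt.not_ge, mul_zero, add_zero]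
      by_cases hrq : r ≤ q
      · have hrq : r = q := hrq.eq_of_not_lt fun h => hpq.2 hlt h
        subst hrq
        have h0 : LinearMap.lsmul R N x = 0 := LinearMap.ext fun y => f.injective (by
          rw [LinearMap.lsmul_apply, map_smul, LinearMap.zero_apply, map_zero]
          exact smul_quotient_eq_zero hxq (f y))
        have h1 : lenAt r (LinearMap.ker (LinearMap.lsmul R N x)) = 1 := by
          rw [LinearMap.ker_eq_top.mpr h0, lenAt_congr r (Submodule.topEquiv.trans f)]
          exact lenAt_residue_eq_one r
        refine ⟨by simp [h1], ?_⟩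
        rw [h1]
        have h2 : LinearMap.range (LinearMap.lsmul R N x) = ⊥ := LinearMap.range_eq_bot.mpr h0
        rw [lenAt_congr r ((Submodule.quotEquivOfEqBot _ h2).trans f)]
        exact lenAt_residue_eq_one r
      · have h0 : lenAt q N = 0 := by
          rw [lenAt_congr q f]
          exact lenAt_quotient_eq_zero q hrq
        have h1 : lenAt q (LinearMap.ker (LinearMap.lsmul R N x)) = 0 :=
          le_antisymm (h0 ▸ lenAt_le_of_injective q _ (Submodule.injective_subtype _)) bot_le
        have h2 : lenAt q (QuotX x N) = 0 :=
          le_antisymm (h0 ▸ lenAt_le_of_surjective q _ (Submodule.mkQ_surjective _)) bot_le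
        simp [h1, h2]
  | exact N₁ N₂ N₃ f g hf hg hfg h₁ h₃ =>
    rw [Module.support_of_exact hfg hf hg] at hM
    obtain ⟨h₁t, h₁e⟩ := h₁ fun r hr => hM r (Or.inl hr)
    obtain ⟨h₃t, h₃e⟩ := h₃ fun r hr => hM r (Or.inr hr)
    have H := lenAt_herbrand q x hf hg hfg
    rw [lenAt_eq_add_of_exact p f g hf hg hfg, mul_add]
    have hfin : lenAt q (LinearMap.ker (LinearMap.lsmul R N₁ x)) +
      lenAt q (LinearMap.ker (LinearMap.lsmul R N₃ x)) ≠ ⊤ := by simp [h₁t, h₃t]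
    refine ⟨?_, ?_⟩
    · exact ne_top_of_le_ne_top hfin (lenAt_le_add_of_exact q _ _ (exact_kerSMulMap x hf hfg))
    · rw [h₁e, h₃e] at H
      refine (ENat.add_right_injective_of_ne_top hfin) (H.trans ?_)
      beta_reduce
      abel

end Herbrand

section Gorenstein

/-- The properties of a Gorenstein local ring of dimension `n` in terms of `ExtR`. -/
structure IsGorensteinOfDim (R : Type u) [CommRing R] [IsLocalRing R] (n : ℕ) : Prop where
  noetherian : IsNoetherianRing R
  height_closedPoint : Order.height (closedPoint R) = n
  subsingleton_ext : ∀ i : ℕ, i ≠ n → Subsingleton (ExtR R i (R ⧸ maximalIdeal R))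
  nonempty_equiv : Nonempty (ExtR R n (R ⧸ maximalIdeal R) ≃ₗ[R] (R ⧸ maximalIdeal R))

theorem exists_covBy_of_coheight {R : Type*} [CommRing R] {k : ℕ} {p : PrimeSpectrum R}
    (hk : Order.coheight p = (k + 1 : ℕ)) : ∃ q, p ⋖ q ∧ Order.coheight q = k := by
  obtain ⟨-, ⟨q, hq, hqk⟩, hle⟩ := Order.coheight_eq_coe_add_one_iff.mp
    (show Order.coheight p = (k : ℕ∞) + 1 by simpa using hk)
  refine ⟨q, ⟨hq, fun r hpr hrp => ?_⟩, hqk⟩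
  have h1 := (Order.coheight_add_one_le hrp).trans (hle r hpr)
  rw [hqk] at h1
  exact absurd h1 (by exact_mod_cast Nat.not_succ_le_self k)

variable {R : Type u} [CommRing R] [IsLocalRing R]

theorem le_closedPoint (p : PrimeSpectrum R) : p ≤ closedPoint R :=
  IsLocalRing.le_maximalIdeal p.isPrime.ne_top

theorem subsingleton_of_lenAt_closedPoint {N : Type*} [AddCommGroup N] [Module R N]
    (h : lenAt (closedPoint R) N = 0) : Subsingleton N := by
  refine ⟨fun x y => ?_⟩
  obtain ⟨s, hs, hxy⟩ := (lenAt_eq_zero_iff _).mp h (x - y)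
  have hu : IsUnit s := by
    by_contra hn
    exact hs ((IsLocalRing.mem_maximalIdeal s).mpr hn)
  rwa [hu.smul_eq_zero, sub_eq_zero] at hxy

namespace IsGorensteinOfDim

variable {n : ℕ} (hR : IsGorensteinOfDim R n)

include hR

theorem height_ne_top (p : PrimeSpectrum R) : Order.height p ≠ ⊤ :=
  ne_top_of_le_ne_top (by rw [hR.height_closedPoint]; simp)
    (Order.height_mono (le_closedPoint p))

theorem coheight_ne_top (p : PrimeSpectrum R) : Order.coheight p ≠ ⊤ := by
  have h : (Order.coheight p : WithBot ℕ∞) ≤ n := by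
    refine (Order.coheight_le_krullDim p).trans ?_
    rw [← Order.height_top_eq_krullDim, ← WithBot.coe_natCast, WithBot.coe_le_coe,
      ← hR.height_closedPoint]
    exact Order.height_mono (le_closedPoint _)
  intro htop
  rw [htop] at h
  exact absurd (WithBot.coe_le_coe.mp (h : ((⊤ : ℕ∞) : WithBot ℕ∞) ≤ ((n : ℕ∞) : WithBot ℕ∞)))
    (by simp)

theorem lenAt_eq_zero_of_lt_height (q : PrimeSpectrum R) {i : ℕ} (p : PrimeSpectrum R)
    (h : i < Order.height p) : lenAt q (ExtR R i (R ⧸ p.asIdeal)) = 0 := by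
  have := hR.noetherian
  refine lenAt_eq_zero_of_le (closedPoint R) (le_closedPoint q) ?_
  clear q
  generalize hI : p.asIdeal = I
  induction I using WellFoundedGT.induction generalizing p i with
  | ind I ih =>
  subst hI
  by_cases hp : p = closedPoint R
  · subst hp
    rw [hR.height_closedPoint] at h
    have := hR.subsingleton_ext i (by simpa using h.ne)
    exact lenAt_subsingleton (N := ExtR R i (R ⧸ maximalIdeal R)) _
  · have hlt : p < closedPoint R := lt_of_le_of_ne (le_closedPoint p) hp
    obtain ⟨x, hxq, hxp⟩ := Set.not_subset.mp hlt.not_ge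
    refine lenAt_ext_eq_zero_of_quotX _ i hxq (smul_injective_quotient_prime p hxp) ?_
    refine lenAt_ext_eq_zero_of_support _ _ fun r hr _ => ?_
    have hpr := lt_of_mem_support_quotX hxp hr
    refine ih _ hpr r ?_ rfl
    refine lt_of_lt_of_le ?_ (Order.height_add_one_le hpr)
    rw [Nat.cast_add, Nat.cast_one]
    exact (ENat.add_lt_add_iff_right (by simp)).mpr h

theorem subsingleton_ext_of_support {i : ℕ} {N : Type u} [AddCommGroup N] [Module R N]
    [Module.Finite R N] (h : ∀ p ∈ Module.support R N, i < Order.height p) :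
    Subsingleton (ExtR R i N) := by
  have := hR.noetherian
  exact subsingleton_of_lenAt_closedPoint (lenAt_ext_eq_zero_of_support _ i fun p hp _ =>
    hR.lenAt_eq_zero_of_lt_height _ p (h p hp))

theorem lenAt_ext_height_ne_zero {k : ℕ} {p : PrimeSpectrum R} (h : Order.height p = k) :
    lenAt p (ExtR R k (R ⧸ p.asIdeal)) ≠ 0 := by
  have := hR.noetherian
  induction k generalizing p with
  | zero =>
    have hmin : p.asIdeal ∈ (Module.annihilator R R).minimalPrimes := by
      have : Module.annihilator R R = ⊥ := by
        rw [Module.annihilator_eq_bot]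
        infer_instance
      rw [this]
      have hp : IsMin p := Order.height_eq_zero.mp (by simpa using h)
      refine ⟨⟨p.isPrime, bot_le⟩, fun J hJ hJp => ?_⟩
      exact hp (b := ⟨J, hJ.1⟩) hJp
    obtain ⟨-, x, hx⟩ := (isAssociatedPrime_iff ..).mp
      (Module.associatedPrimes.minimalPrimes_annihilator_subset_associatedPrimes R R hmin)
    let φ : (R ⧸ p.asIdeal) →ₗ[R] R := Submodule.liftQ _ (LinearMap.toSpanSingleton R R x) (by
      rw [hx]
      intro a ha
      simpa [Submodule.mem_colon_singleton] using ha)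
    rw [lenAt_congr p ExtR.zeroEquiv]
    intro h0
    obtain ⟨s, hs, hφ⟩ := (lenAt_eq_zero_iff p).mp h0 φ
    apply hs
    rw [hx, Submodule.mem_colon_singleton]
    have h1 : s • φ (Submodule.mkQ _ 1) = 0 := DFunLike.congr_fun hφ (Submodule.Quotient.mk 1)
    rwa [Submodule.mkQ_apply, Submodule.liftQ_apply, LinearMap.toSpanSingleton_apply,
      one_smul] at h1
  | succ k ih =>
    obtain ⟨-, ⟨p', hp', hk⟩, hle⟩ := Order.height_eq_coe_add_one_iff.mp
      (show Order.height p = (k : ℕ∞) + 1 by simpa using h)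
    refine lenAt_ext_succ_ne_zero_of_covBy k ⟨hp', fun r hpr hrp => ?_⟩ (ih hk)
    have h1 := (Order.height_add_one_le hpr).trans (hle r hrp)
    rw [hk] at h1
    exact absurd h1 (by exact_mod_cast Nat.not_succ_le_self k)

theorem add_coheight_eq {k : ℕ} {p : PrimeSpectrum R} {i : ℕ}
    (hk : Order.coheight p = k) (h : lenAt p (ExtR R i (R ⧸ p.asIdeal)) ≠ 0) : i + k = n := by
  have := hR.noetherian
  induction k generalizing p i with
  | zero =>
    have hp : p = closedPoint R :=
      (Order.coheight_eq_zero.mp (by simpa using hk)).eq_of_le (le_closedPoint p)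
    subst hp
    by_contra hi
    have := hR.subsingleton_ext i hi
    exact h (lenAt_subsingleton (N := ExtR R i (R ⧸ maximalIdeal R)) _)
  | succ k ih =>
    obtain ⟨q, hcov, hqk⟩ := exists_covBy_of_coheight hk
    have := ih hqk (lenAt_ext_succ_ne_zero_of_covBy i hcov h)
    omega

theorem height_add_coheight (p : PrimeSpectrum R) : Order.height p + Order.coheight p = n := by
  obtain ⟨k, hk⟩ := ENat.ne_top_iff_exists.mp (hR.height_ne_top p)
  obtain ⟨l, hl⟩ := ENat.ne_top_iff_exists.mp (hR.coheight_ne_top p)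
  rw [← hk, ← hl]
  exact_mod_cast hR.add_coheight_eq hl.symm (hR.lenAt_ext_height_ne_zero hk.symm)

theorem lenAt_ext_eq_zero_of_ne {p : PrimeSpectrum R} {i : ℕ} (h : Order.height p ≠ i) :
    lenAt p (ExtR R i (R ⧸ p.asIdeal)) = 0 := by
  by_contra h0
  obtain ⟨l, hl⟩ := ENat.ne_top_iff_exists.mp (hR.coheight_ne_top p)
  have h1 := hR.add_coheight_eq hl.symm h0
  have h2 := hR.height_add_coheight p
  rw [← hl, ← h1, Nat.cast_add] at h2
  exact h ((ENat.add_left_injective_of_ne_top (by simp)) h2)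

theorem height_eq_of_covBy {p q : PrimeSpectrum R} (h : p ⋖ q) {k : ℕ}
    (hp : Order.height p = k) : Order.height q = (k + 1 : ℕ) := by
  have := hR.noetherian
  by_contra h0
  exact lenAt_ext_succ_ne_zero_of_covBy k h (hR.lenAt_ext_height_ne_zero hp)
    (hR.lenAt_ext_eq_zero_of_ne h0)

theorem lenAt_ext_height_le_one {k : ℕ} {p : PrimeSpectrum R} (h : Order.height p = k) :
    lenAt p (ExtR R k (R ⧸ p.asIdeal)) ≤ 1 := by
  have := hR.noetherian
  obtain ⟨l, hl⟩ := ENat.ne_top_iff_exists.mp (hR.coheight_ne_top p)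
  induction l generalizing p k with
  | zero =>
    have hp : p = closedPoint R :=
      (Order.coheight_eq_zero.mp (by simpa using hl.symm)).eq_of_le (le_closedPoint p)
    subst hp
    have hk : k = n := by exact_mod_cast h.symm.trans hR.height_closedPoint
    subst hk
    obtain ⟨e⟩ := hR.nonempty_equiv
    exact ((lenAt_congr (closedPoint R) e).trans (lenAt_residue_eq_one _)).le
  | succ l ih =>
    obtain ⟨q, hpq, hq⟩ := exists_covBy_of_coheight hl.symm
    obtain ⟨x, hxq, hxp⟩ := Set.not_subset.mp hpq.1.not_ge
    obtain ⟨-, h2⟩ := lenAt_ker_and_quotX (M := ExtR R k (R ⧸ p.asIdeal)) hpq hxq hxp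
      (fun r hr a ha => mem_of_mem_support hr fun ξ =>
        ExtR.smul_eq_zero_of_annihilates k (smul_quotient_eq_zero ha) ξ)
    obtain ⟨δ, hδ⟩ := exists_quotX_ext_injective k (smul_injective_quotient_prime p hxp)
    have hsupp : ∀ r ∈ Module.support R (QuotX x (R ⧸ p.asIdeal)), r ≤ q → r = q :=
      fun r hr hrq => eq_of_mem_support_quotX hpq hxp hr hrq
    have h3 := (lenAt_le_of_injective q δ hδ).trans (lenAt_ext_le q (k + 1) hsupp)
    have h4 := ih (hR.height_eq_of_covBy hpq h) hq.symm
    rw [h2] at h3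
    have h5 := (le_add_self.trans h3).trans (mul_le_mul_right h4 _)
    exact (ENat.mul_le_mul_left_iff (lenAt_quotX_prime_ne_zero hpq.1.le hxq)
      (lenAt_ne_top_of_support q hsupp)).mp h5

theorem lenAt_ext_height {k : ℕ} {p : PrimeSpectrum R} (h : Order.height p = k) :
    lenAt p (ExtR R k (R ⧸ p.asIdeal)) = 1 :=
  le_antisymm (hR.lenAt_ext_height_le_one h)
    (Order.one_le_iff_ne_zero.mpr (hR.lenAt_ext_height_ne_zero h))

theorem lenAt_ext_eq_lenAt {k : ℕ} {p : PrimeSpectrum R} (h : Order.height p = k) {N : Type u}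
    [AddCommGroup N] [Module R N] [Module.Finite R N]
    (hN : ∀ r ∈ Module.support R N, r ≤ p → r = p) : lenAt p (ExtR R k N) = lenAt p N := by
  have := hR.noetherian
  rw [lenAt_ext_eq p k hN fun j hj => hR.lenAt_ext_eq_zero_of_ne (by
    rw [h]; exact_mod_cast hj.symm), hR.lenAt_ext_height h, mul_one]

end IsGorensteinOfDim
end Gorenstein

section Duality

/-- The linear map `R ⧸ J → N` sending `1` to an element `x` killed by `J`. -/
def eltMap {R : Type*} [CommRing R] {J : Ideal R} {N : Type*} [AddCommGroup N] [Module R N] (x : N)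
    (hx : ∀ a ∈ J, a • x = 0) : (R ⧸ J) →ₗ[R] N :=
  Submodule.liftQ J (LinearMap.toSpanSingleton R N x) fun a ha => hx a ha

@[simp]
theorem eltMap_mk {R : Type*} [CommRing R] {J : Ideal R} {N : Type*} [AddCommGroup N] [Module R N]
    (x : N) (hx : ∀ a ∈ J, a • x = 0) (r : R) :
    eltMap x hx (Ideal.Quotient.mk J r) = r • x :=
  rfl

@[simp]
theorem eltMap_one {R : Type*} [CommRing R] {J : Ideal R} {N : Type*} [AddCommGroup N] [Module R N]
    (x : N) (hx : ∀ a ∈ J, a • x = 0) : eltMap x hx 1 = x :=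
  one_smul R x

theorem quotient_hom_ext {R : Type*} [CommRing R] {J : Ideal R} {N : Type*} [AddCommGroup N]
    [Module R N] {f g : (R ⧸ J) →ₗ[R] N}
    (h : f 1 = g 1) : f = g :=
  Submodule.linearMap_qext _ (LinearMap.ext_ring h)

variable {R : Type u} [CommRing R] (J : Ideal R) (c : ℕ)

variable {N N' : Type u} [AddCommGroup N] [Module R N] [AddCommGroup N'] [Module R N']

/-- The natural map from `Ext^c(N, R)` to the linear maps from `N` to `Ext^c(R ⧸ J, R)`. -/
def extToHom (hN : ∀ a ∈ J, ∀ x : N, a • x = 0) :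
    ExtR R c N →ₗ[R] N →ₗ[R] ExtR R c (R ⧸ J) where
  toFun ξ :=
    { toFun := fun x => ExtR.map c (eltMap x fun a ha => hN a ha x) ξ
      map_add' := fun x y => by
        rw [← ExtR.map_add]
        congr 2
        exact quotient_hom_ext (by simp)
      map_smul' := fun r x => by
        rw [RingHom.id_apply, ← ExtR.map_smul]
        congr 2
        exact quotient_hom_ext (by simp) }
  map_add' ξ η := by ext x; simp
  map_smul' r ξ := by ext x; simp

variable {J}

theorem extToHom_apply (hN : ∀ a ∈ J, ∀ x : N, a • x = 0) (ξ : ExtR R c N) (x : N) :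
    extToHom J c hN ξ x = ExtR.map c (eltMap x fun a ha => hN a ha x) ξ :=
  rfl

theorem extToHom_map (hN : ∀ a ∈ J, ∀ x : N, a • x = 0) (hN' : ∀ a ∈ J, ∀ x : N', a • x = 0)
    (f : N →ₗ[R] N') (ξ : ExtR R c N') :
    extToHom J c hN (ExtR.map c f ξ) = extToHom J c hN' ξ ∘ₗ f := by
  ext x
  rw [LinearMap.comp_apply, extToHom_apply, extToHom_apply, ← ExtR.map_comp]
  congr 2
  exact quotient_hom_ext (by simp)

theorem extToHom_pi_surjective (k : ℕ) :
    Function.Surjective (extToHom J c (N := Fin k → R ⧸ J)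
      fun _ ha x => funext fun i => smul_quotient_eq_zero ha (x i)) := by
  intro g
  refine ⟨∑ i, ExtR.map c (LinearMap.proj i) (g (Pi.single i 1)), ?_⟩
  refine LinearMap.pi_ext' fun j => quotient_hom_ext ?_
  rw [LinearMap.comp_apply, LinearMap.comp_apply, extToHom_apply, map_sum]
  simp_rw [← ExtR.map_comp]
  rw [Finset.sum_eq_single j]
  · convert ExtR.map_id c _ using 3
    · exact quotient_hom_ext (by simp)
    · simp
  · intro i _ hij
    convert ExtR.map_zero c _ using 3
    exact quotient_hom_ext (by simp [hij])
  · simp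

section

variable {c} [IsNoetherianRing R]
  (hc : ∀ (i : ℕ) (N : Type u) [AddCommGroup N] [Module R N] [Module.Finite R N],
    (∀ a ∈ J, ∀ x : N, a • x = 0) → i < c → Subsingleton (ExtR R i N))

include hc

theorem ext_map_injective [Module.Finite R N] (hN : ∀ a ∈ J, ∀ x : N, a • x = 0)
    {g : N →ₗ[R] N'} (hg : Function.Surjective g) : Function.Injective (ExtR.map c g) := by
  cases c with
  | zero => exact ExtR.map_zero_injective hg
  | succ i =>
    obtain ⟨δ, -, hδ⟩ := ExtR.exists_delta i (LinearMap.ker g).injective_subtype hg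
      (LinearMap.exact_subtype_ker_map g)
    have := hc i (LinearMap.ker g) (fun a ha x => Subtype.ext (hN a ha x)) (Nat.lt_succ_self i)
    rw [injective_iff_map_eq_zero]
    intro ξ hξ
    obtain ⟨η, rfl⟩ := (hδ ξ).mp hξ
    rw [Subsingleton.elim η 0, map_zero]

theorem extToHom_injective [Module.Finite R N] (hN : ∀ a ∈ J, ∀ x : N, a • x = 0) :
    Function.Injective (extToHom J c hN) := by
  induction ‹Module.Finite R N› using
    IsNoetherianRing.induction_on_isQuotientEquivQuotientPrime R with
  | subsingleton N =>
    have := ExtR.subsingleton_of_subsingleton (R := R) c (N := N)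
    exact Function.injective_of_subsingleton _
  | quotient N p f =>
    have h1 : Function.Surjective (eltMap (f.symm (Ideal.Quotient.mk _ 1)) fun a ha =>
        hN a ha (f.symm (Ideal.Quotient.mk _ 1))) := by
      intro y
      obtain ⟨r, hr⟩ := Ideal.Quotient.mk_surjective (f y)
      refine ⟨Ideal.Quotient.mk J r, ?_⟩
      rw [eltMap_mk, ← map_smul, f.symm_apply_eq, ← hr]
      exact congrArg _ (mul_one r)
    intro ξ η h
    exact ext_map_injective hc (fun a ha y => smul_quotient_eq_zero ha y) h1
      (DFunLike.congr_fun h (f.symm (Ideal.Quotient.mk _ 1)))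
  | exact N₁ N₂ N₃ f g hf hg hfg h₁ h₃ =>
    have hN₁ : ∀ a ∈ J, ∀ x : N₁, a • x = 0 := fun a ha x => hf (by rw [map_smul, hN a ha, map_zero])
    have hN₃ : ∀ a ∈ J, ∀ x : N₃, a • x = 0 := fun a ha x => by
      obtain ⟨x, rfl⟩ := hg x
      rw [← map_smul, hN a ha, map_zero]
    rw [injective_iff_map_eq_zero]
    intro ξ hξ
    have hξ₁ : ExtR.map c f ξ = 0 := (injective_iff_map_eq_zero _).mp (h₁ hN₁) _ (by
      rw [extToHom_map c hN₁ hN, hξ, LinearMap.zero_comp])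
    obtain ⟨η, rfl⟩ := (ExtR.exact_map c hf hg hfg ξ).mp hξ₁
    rw [extToHom_map c hN hN₃] at hξ
    have hη : extToHom J c hN₃ η = 0 := by
      ext y
      obtain ⟨y, rfl⟩ := hg y
      exact DFunLike.congr_fun hξ y
    rw [(injective_iff_map_eq_zero _).mp (h₃ hN₃) η hη, map_zero]

theorem extToHom_bijective [Module.Finite R N] (hN : ∀ a ∈ J, ∀ x : N, a • x = 0) :
    Function.Bijective (extToHom J c hN) := by
  refine ⟨extToHom_injective hc hN, fun g => ?_⟩
  obtain ⟨k, f, hf⟩ := Module.Finite.exists_fin' R N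
  let π : (Fin k → R ⧸ J) →ₗ[R] N :=
    ∑ i, eltMap (f (Pi.single i 1)) (fun a ha => hN a ha _) ∘ₗ LinearMap.proj i
  have hπ : Function.Surjective π := by
    intro y
    obtain ⟨w, rfl⟩ := hf y
    refine ⟨fun i => Ideal.Quotient.mk J (w i), ?_⟩
    conv_rhs => rw [← Finset.univ_sum_single w, map_sum]
    simp only [π, LinearMap.sum_apply, LinearMap.comp_apply, LinearMap.proj_apply, eltMap_mk]
    refine Finset.sum_congr rfl fun i _ => ?_
    rw [← map_smul, ← Pi.single_smul, smul_eq_mul, mul_one]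
  obtain ⟨ξ, hξ⟩ := extToHom_pi_surjective c k (g ∘ₗ π)
  have hK : ∀ a ∈ J, ∀ x : LinearMap.ker π, a • x = 0 := fun a ha x =>
    Subtype.ext (funext fun i => smul_quotient_eq_zero ha _)
  have h0 : ExtR.map c (LinearMap.ker π).subtype ξ = 0 :=
    (injective_iff_map_eq_zero _).mp (extToHom_injective hc hK) _ (by
      rw [extToHom_map c hK (fun _ ha x => funext fun i => smul_quotient_eq_zero ha (x i)), hξ]
      ext x
      have := x.2
      rw [LinearMap.mem_ker] at this
      simp [this])
  obtain ⟨η, rfl⟩ := (ExtR.exact_map c (LinearMap.ker π).injective_subtype hπ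
    (LinearMap.exact_subtype_ker_map π) ξ).mp h0
  refine ⟨η, ?_⟩
  rw [extToHom_map c _ hN] at hξ
  ext y
  obtain ⟨y, rfl⟩ := hπ y
  exact DFunLike.congr_fun hξ y

end

end Duality

section Endomorphisms

/-- Every nonzero element of a module over a Noetherian ring has a multiple whose annihilator
is prime. -/
theorem exists_prime_annihilator {R : Type*} [CommRing R] [IsNoetherianRing R] {M : Type*}
    [AddCommGroup M] [Module R M] {y : M} (hy : y ≠ 0) :
    ∃ (p : PrimeSpectrum R) (r : R), ∀ a : R, a ∈ p.asIdeal ↔ a • r • y = 0 := by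
  have : Nontrivial (Submodule.span R {y}) :=
    Submodule.nontrivial_iff_ne_bot.mpr (by simpa using hy)
  obtain ⟨p, hp⟩ := associatedPrimes.nonempty R (Submodule.span R {y})
  obtain ⟨hp, ⟨x, hx⟩, hpx⟩ := (isAssociatedPrime_iff ..).mp hp
  obtain ⟨r, rfl⟩ := Submodule.mem_span_singleton.mp hx
  refine ⟨⟨p, hp⟩, r, fun a => ?_⟩
  change a ∈ p ↔ _
  rw [hpx, Submodule.mem_colon_singleton, Submodule.mem_bot, Subtype.ext_iff]
  rfl

/-- Evaluation at `1` identifies the maps from `R ⧸ K` to a module killed by `K`. -/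
def quotientHomEquiv {R : Type*} [CommRing R] (K : Ideal R) (M : Type*) [AddCommGroup M]
    [Module R M] (hM : ∀ a ∈ K, ∀ x : M, a • x = 0) : ((R ⧸ K) →ₗ[R] M) ≃ₗ[R] M where
  toFun f := f 1
  map_add' _ _ := rfl
  map_smul' _ _ := rfl
  invFun x := eltMap x fun a ha => hM a ha x
  left_inv f := quotient_hom_ext (by simp)
  right_inv x := by simp

theorem smul_ext_quotient_eq_zero {R : Type u} [CommRing R] {J : Ideal R} (i : ℕ) {a : R}
    (ha : a ∈ J) (ξ : ExtR R i (R ⧸ J)) : a • ξ = 0 :=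
  ExtR.smul_eq_zero_of_annihilates i (smul_quotient_eq_zero ha) ξ

namespace IsGorensteinOfDim

variable {R : Type u} [CommRing R] [IsLocalRing R] {n : ℕ} (hR : IsGorensteinOfDim R n)
  {J : Ideal R} {c : ℕ} (hJ : ∀ p : PrimeSpectrum R, J ≤ p.asIdeal → c ≤ Order.height p)

include hR in
theorem eq_of_le_of_height_le {p q : PrimeSpectrum R} (h : p ≤ q)
    (hpq : Order.height q ≤ Order.height p) : p = q := by
  by_contra hne
  have h1 := (Order.height_add_one_le (lt_of_le_of_ne h hne)).trans hpq
  obtain ⟨k, hk⟩ := ENat.ne_top_iff_exists.mp (hR.height_ne_top p)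
  rw [← hk] at h1
  exact absurd h1 (by exact_mod_cast Nat.not_succ_le_self k)

include hR hJ

theorem subsingleton_ext_of_lt (i : ℕ) (N : Type u) [AddCommGroup N] [Module R N]
    [Module.Finite R N] (hN : ∀ a ∈ J, ∀ x : N, a • x = 0) (hi : i < c) :
    Subsingleton (ExtR R i N) :=
  hR.subsingleton_ext_of_support fun p hp =>
    lt_of_lt_of_le (by exact_mod_cast hi) (hJ p fun a ha => mem_of_mem_support hp (hN a ha))

theorem eq_of_mem_support {p : PrimeSpectrum R} (hp : Order.height p = c)
    {N : Type*} [AddCommGroup N] [Module R N] (hN : ∀ a ∈ J, ∀ x : N, a • x = 0) :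
    ∀ r ∈ Module.support R N, r ≤ p → r = p := fun r hr hrp =>
  hR.eq_of_le_of_height_le hrp
    (hp.le.trans (hJ r fun a ha => mem_of_mem_support hr (hN a ha)))

theorem height_of_annihilator {p : PrimeSpectrum R} {y : ExtR R c (R ⧸ J)}
    (hp : ∀ a : R, a ∈ p.asIdeal ↔ a • y = 0) : J ≤ p.asIdeal ∧ Order.height p = c := by
  have := hR.noetherian
  have hJp : J ≤ p.asIdeal := fun a ha => (hp a).mpr (smul_ext_quotient_eq_zero c ha y)
  refine ⟨hJp, (hJ p hJp).antisymm' (not_lt.mp fun hlt => ?_)⟩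
  have : Subsingleton (ExtR R c (R ⧸ p.asIdeal)) :=
    hR.subsingleton_ext_of_support fun r hr => lt_of_lt_of_le hlt
      (Order.height_mono fun a ha => mem_of_mem_support hr (smul_quotient_eq_zero ha))
  obtain ⟨ξ, hξ⟩ := (extToHom_bijective (hR.subsingleton_ext_of_lt hJ)
    (fun a ha => smul_quotient_eq_zero (hJp ha))).2 (eltMap y fun a ha => (hp a).mp ha)
  rw [Subsingleton.elim ξ 0, map_zero] at hξ
  have h1 : y = 0 := by simpa using (DFunLike.congr_fun hξ 1).symm
  exact p.isPrime.ne_top ((Ideal.eq_top_iff_one _).mpr ((hp 1).mpr (by simp [h1])))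

theorem exists_prime_annihilator_ext {y : ExtR R c (R ⧸ J)} (hy : y ≠ 0) :
    ∃ (p : PrimeSpectrum R) (r : R), (J ≤ p.asIdeal ∧ Order.height p = c) ∧
      ∀ a : R, a ∈ p.asIdeal ↔ a • r • y = 0 := by
  have := hR.noetherian
  obtain ⟨p, r, h⟩ := exists_prime_annihilator (R := R) hy
  exact ⟨p, r, hR.height_of_annihilator hJ h, h⟩

theorem eq_zero_of_smul {p : PrimeSpectrum R} (hp : Order.height p = c)
    {y : ExtR R c (R ⧸ J)} (hpy : ∀ a ∈ p.asIdeal, a • y = 0) {t : R} (ht : t ∉ p.asIdeal)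
    (hty : t • y = 0) : y = 0 := by
  by_contra hy
  obtain ⟨q, r, ⟨-, hq⟩, hann⟩ := hR.exists_prime_annihilator_ext hJ hy
  have h1 : p = q := hR.eq_of_le_of_height_le
    (fun a ha => (hann a).mpr (by rw [smul_comm, hpy a ha, smul_zero])) (by rw [hp, hq])
  subst h1
  exact ht ((hann t).mpr (by rw [smul_comm, hty, smul_zero]))

theorem exists_smul_end_eq {p : PrimeSpectrum R} (hp : Order.height p = c)
    (f : Module.End R (ExtR R c (R ⧸ J))) :
    ∃ s ∉ p.asIdeal, ∃ r : R, ∀ y, s • f y = r • y := by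
  have := hR.noetherian
  have hc := hR.subsingleton_ext_of_lt hJ
  let M := ExtR R c (R ⧸ J)
  let K := Module.annihilator R M
  have hJK : J ≤ K := fun a ha => Module.mem_annihilator.mpr (smul_ext_quotient_eq_zero c ha)
  have hK : ∀ a ∈ K, ∀ x : M, a • x = 0 := fun a ha => Module.mem_annihilator.mp ha
  have hJK' : ∀ a ∈ J, ∀ x : R ⧸ K, a • x = 0 := fun a ha => smul_quotient_eq_zero (hJK ha)
  have hJM : ∀ a ∈ J, ∀ x : M, a • x = 0 := fun a ha => smul_ext_quotient_eq_zero c ha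
  have h1 : lenAt p (R ⧸ K) = lenAt p M :=
    (hR.lenAt_ext_eq_lenAt hp (hR.eq_of_mem_support hJ hp hJK')).symm.trans
      ((lenAt_congr p (LinearEquiv.ofBijective _ (extToHom_bijective hc hJK'))).trans
        (lenAt_congr p (quotientHomEquiv K M hK)))
  have h2 : lenAt p (Module.End R M) = lenAt p M :=
    (lenAt_congr p (LinearEquiv.ofBijective _ (extToHom_bijective hc hJM))).symm.trans
      (hR.lenAt_ext_eq_lenAt hp (hR.eq_of_mem_support hJ hp hJM))
  let ι : (R ⧸ K) →ₗ[R] Module.End R M :=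
    eltMap LinearMap.id fun a ha => LinearMap.ext (hK a ha)
  have hι : Function.Injective ι := by
    rw [injective_iff_map_eq_zero]
    intro x hx
    obtain ⟨x, rfl⟩ := Ideal.Quotient.mk_surjective x
    rw [Ideal.Quotient.eq_zero_iff_mem]
    exact Module.mem_annihilator.mpr fun y => DFunLike.congr_fun hx y
  have h3 := lenAt_eq_submodule_add_quotient p (LinearMap.range ι)
  rw [h2, ← h1, ← lenAt_congr p (LinearEquiv.ofInjective ι hι)] at h3
  have h4 : lenAt p (Module.End R M ⧸ LinearMap.range ι) = 0 :=
    (ENat.add_right_injective_of_ne_top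
      (lenAt_ne_top_of_support p (hR.eq_of_mem_support hJ hp hJK'))
      ((add_zero _).trans h3)).symm
  obtain ⟨s, hs, hsf⟩ := (lenAt_eq_zero_iff p).mp h4 (Submodule.mkQ _ f)
  rw [← map_smul, Submodule.mkQ_apply, Submodule.Quotient.mk_eq_zero] at hsf
  obtain ⟨x, hx⟩ := hsf
  obtain ⟨r, rfl⟩ := Ideal.Quotient.mk_surjective x
  exact ⟨s, hs, r, fun y => (DFunLike.congr_fun hx y).symm⟩

theorem end_mul_comm (f g : Module.End R (ExtR R c (R ⧸ J))) : f * g = g * f := by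
  by_contra hne
  obtain ⟨y, hy⟩ : ∃ y, f (g y) - g (f y) ≠ 0 := by
    by_contra! h
    exact hne (LinearMap.ext fun y => sub_eq_zero.mp (h y))
  obtain ⟨p, r, ⟨-, hp⟩, hann⟩ := hR.exists_prime_annihilator_ext hJ hy
  obtain ⟨s, hs, a, hf⟩ := hR.exists_smul_end_eq hJ hp f
  obtain ⟨t, ht, b, hg⟩ := hR.exists_smul_end_eq hJ hp g
  have h1 : (s * t) • (f (g y) - g (f y)) = 0 := by
    have hfg : (s * t) • f (g y) = (a * b) • y := by
      rw [mul_comm, mul_smul, hf, smul_comm, hg, mul_smul]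
    have hgf : (s * t) • g (f y) = (a * b) • y := by
      rw [mul_smul, hg, smul_comm, hf, mul_comm, mul_smul]
    rw [smul_sub, hfg, hgf, sub_self]
  exact p.isPrime.mul_notMem hs ht ((hann _).mpr (by rw [smul_comm, h1, smul_zero]))

/-- If `e` is idempotent and `p` is minimal over `J` of height `c`, then `e` is the identity
or zero on the elements killed by `p`. -/
theorem idempotent_apply_eq {p : PrimeSpectrum R} (hp : Order.height p = c)
    {e : Module.End R (ExtR R c (R ⧸ J))} (he : ∀ y, e (e y) = e y)
    (hpe : ∃ z, (∀ a ∈ p.asIdeal, a • z = 0) ∧ e z ≠ 0) {z : ExtR R c (R ⧸ J)}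
    (hz : ∀ a ∈ p.asIdeal, a • z = 0) : e z = z := by
  obtain ⟨z₀, hz₀, hez₀⟩ := hpe
  obtain ⟨s, hs, r, hsr⟩ := hR.exists_smul_end_eq hJ hp e
  have he' : ∀ z : ExtR R c (R ⧸ J), (∀ a ∈ p.asIdeal, a • z = 0) →
      ∀ a ∈ p.asIdeal, a • e z = 0 := fun z hz a ha => by rw [← map_smul, hz a ha, map_zero]
  have hr : r ∉ p.asIdeal := fun hr => hez₀ <|
    hR.eq_zero_of_smul hJ hp (he' z₀ hz₀) hs (by rw [hsr, hz₀ r hr])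
  refine (sub_eq_zero.mp (hR.eq_zero_of_smul hJ hp (fun a ha => ?_) hr ?_)).symm
  · rw [smul_sub, hz a ha, he' z hz a ha, sub_zero]
  · rw [smul_sub, ← hsr, ← hsr, he, sub_self]

omit hJ in
theorem lenAt_ext_succ_eq_zero {p P : PrimeSpectrum R} (hp : Order.height p = c)
    (hP : Order.height P = (c + 1 : ℕ)) (hpP : p ≤ P) :
    lenAt P (ExtR R (c + 1) (R ⧸ p.asIdeal)) = 0 := by
  have := hR.noetherian
  have hne : p ≠ P := by
    rintro rfl
    rw [hp] at hP
    exact absurd hP (by exact_mod_cast (Nat.succ_ne_self c).symm)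
  have hcov : p ⋖ P := by
    refine ⟨lt_of_le_of_ne hpP hne, fun r hpr hrP => ?_⟩
    have h1 := Order.height_add_one_le hpr
    refine hrP.ne (hR.eq_of_le_of_height_le hrP.le ?_)
    rw [hP, Nat.cast_add, ← hp]
    exact h1
  obtain ⟨x, hxP, hxp⟩ := Set.not_subset.mp hcov.1.not_ge
  refine lenAt_ext_eq_zero_of_quotX P _ hxP (smul_injective_quotient_prime p hxp)
    (le_antisymm ((lenAt_ext_le P _ fun r hr hrP =>
      eq_of_mem_support_quotX hcov hxp hr hrP).trans ?_) bot_le)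
  rw [hR.lenAt_ext_eq_zero_of_ne (by
    rw [hP]
    exact_mod_cast (Nat.succ_ne_self _).symm), mul_zero]

/-- If the elements killed by `p ⊓ q` are sums of elements killed by `p` and `q`, then there is
no prime of height `c + 1` containing both `p` and `q`. -/
theorem height_ne_of_forall_exists_add {p q P : PrimeSpectrum R} (hp : Order.height p = c)
    (hq : Order.height q = c) (hpq : p ≠ q) (hJp : J ≤ p.asIdeal) (hJq : J ≤ q.asIdeal)
    (hpP : p ≤ P) (hqP : q ≤ P)
    (h : ∀ z : ExtR R c (R ⧸ J), (∀ a ∈ p.asIdeal ⊓ q.asIdeal, a • z = 0) →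
      ∃ z₁ z₂, z = z₁ + z₂ ∧ (∀ a ∈ p.asIdeal, a • z₁ = 0) ∧ ∀ a ∈ q.asIdeal, a • z₂ = 0) :
    Order.height P ≠ (c + 1 : ℕ) := by
  intro hP
  have := hR.noetherian
  have hc := hR.subsingleton_ext_of_lt hJ
  let f : (R ⧸ p.asIdeal ⊓ q.asIdeal) →ₗ[R] (R ⧸ p.asIdeal) × (R ⧸ q.asIdeal) :=
    eltMap (1, 1) fun a ha => Prod.ext (smul_quotient_eq_zero ha.1 _) (smul_quotient_eq_zero ha.2 _)
  let g₁ : (R ⧸ p.asIdeal) →ₗ[R] (R ⧸ p.asIdeal ⊔ q.asIdeal) :=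
    eltMap 1 fun a ha => smul_quotient_eq_zero (le_sup_left (α := Ideal R) ha) _
  let g₂ : (R ⧸ q.asIdeal) →ₗ[R] (R ⧸ p.asIdeal ⊔ q.asIdeal) :=
    eltMap (-1) fun a ha => smul_quotient_eq_zero (le_sup_right (α := Ideal R) ha) _
  have hf : Function.Injective f := by
    rw [injective_iff_map_eq_zero]
    intro x hx
    obtain ⟨x, rfl⟩ := Ideal.Quotient.mk_surjective x
    rw [eltMap_mk, Prod.ext_iff] at hx
    rw [Ideal.Quotient.eq_zero_iff_mem]
    constructor
    · simpa [Algebra.smul_def, Ideal.Quotient.eq_zero_iff_mem] using hx.1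
    · simpa [Algebra.smul_def, Ideal.Quotient.eq_zero_iff_mem] using hx.2
  have hg : Function.Surjective (g₁.coprod g₂) := by
    intro y
    obtain ⟨y, rfl⟩ := Ideal.Quotient.mk_surjective y
    refine ⟨(Ideal.Quotient.mk _ y, 0), ?_⟩
    simp [g₁, Algebra.smul_def]
  have hfg : Function.Exact f (g₁.coprod g₂) := by
    rintro ⟨x, y⟩
    obtain ⟨x, rfl⟩ := Ideal.Quotient.mk_surjective x
    obtain ⟨y, rfl⟩ := Ideal.Quotient.mk_surjective y
    constructor
    · intro hxy
      have h1 : Ideal.Quotient.mk (p.asIdeal ⊔ q.asIdeal) (x - y) = 0 := by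
        rw [← hxy]
        simp [g₁, g₂, Algebra.smul_def, sub_eq_add_neg]
      obtain ⟨a, ha, b, hb, hab⟩ := Submodule.mem_sup.mp (Ideal.Quotient.eq_zero_iff_mem.mp h1)
      refine ⟨Ideal.Quotient.mk _ (x - a), ?_⟩
      rw [eltMap_mk]
      refine Prod.ext ?_ ?_
      · simpa [Algebra.smul_def, Ideal.Quotient.eq_zero_iff_mem] using ha
      · have : x - a = y + b := by linear_combination -hab
        simpa [this, Algebra.smul_def, Ideal.Quotient.eq_zero_iff_mem] using hb
    · rintro ⟨z, hz⟩
      obtain ⟨z, rfl⟩ := Ideal.Quotient.mk_surjective z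
      rw [← hz]
      simp [f, g₁, g₂]
  have hJ₁ : ∀ a ∈ J, ∀ x : R ⧸ p.asIdeal ⊓ q.asIdeal, a • x = 0 := fun a ha =>
    smul_quotient_eq_zero ⟨hJp ha, hJq ha⟩
  have hJ₂ : ∀ a ∈ J, ∀ x : (R ⧸ p.asIdeal) × (R ⧸ q.asIdeal), a • x = 0 := fun a ha x =>
    Prod.ext (smul_quotient_eq_zero (hJp ha) _) (smul_quotient_eq_zero (hJq ha) _)
  have hsurj : Function.Surjective (ExtR.map c f) := by
    intro ξ
    obtain ⟨z₁, z₂, hz, hz₁, hz₂⟩ := h (extToHom J c hJ₁ ξ 1) fun a ha => by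
      rw [← map_smul, smul_quotient_eq_zero ha, map_zero]
    obtain ⟨η, hη⟩ := (extToHom_bijective hc hJ₂).2
      ((eltMap z₁ hz₁).coprod (eltMap z₂ hz₂))
    refine ⟨η, extToHom_injective hc hJ₁ (quotient_hom_ext ?_)⟩
    rw [extToHom_map c hJ₁ hJ₂, hη, hz]
    simp [f]
  obtain ⟨δ, h1, h2⟩ := ExtR.exists_delta c hf hg hfg
  have hinj : Function.Injective (ExtR.map (c + 1) (g₁.coprod g₂)) := by
    rw [injective_iff_map_eq_zero]
    intro ξ hξ
    obtain ⟨η, rfl⟩ := (h2 ξ).mp hξ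
    exact (h1 η).mpr (hsurj η)
  have hle := (lenAt_le_of_injective P _ hinj).trans (lenAt_le_add_of_exact P _ _
    (ExtR.exact_map (c + 1) (LinearMap.inl_injective (R := R) (M := R ⧸ p.asIdeal)
      (M₂ := R ⧸ q.asIdeal)) LinearMap.snd_surjective Function.Exact.inl_snd))
  rw [hR.lenAt_ext_succ_eq_zero hp hP hpP, hR.lenAt_ext_succ_eq_zero hq hP hqP, add_zero,
    hR.lenAt_ext_eq_lenAt hP fun r hr hrP => ?_] at hle
  · exact lenAt_quotient_ne_zero P (J := p.asIdeal ⊔ q.asIdeal) (sup_le hpP hqP)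
      (le_antisymm hle bot_le)
  · have hle : p.asIdeal ⊔ q.asIdeal ≤ r.asIdeal := fun a ha =>
      mem_of_mem_support hr (smul_quotient_eq_zero ha)
    have hpr : p ≤ r := le_sup_left.trans hle
    have hqr : q ≤ r := le_sup_right.trans hle
    refine hR.eq_of_le_of_height_le hrP ?_
    rw [hP, Nat.cast_add, ← hp]
    refine Order.height_add_one_le (lt_of_le_of_ne hpr ?_)
    rintro rfl
    exact hpq (hR.eq_of_le_of_height_le hqr (by rw [hp, hq])).symm

theorem idempotent_eq_zero_or_one
    (hconn : ∀ X : Set (PrimeSpectrum R),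
      (∃ p, J ≤ p.asIdeal ∧ Order.height p = c ∧ p ∈ X) →
      (∃ p, J ≤ p.asIdeal ∧ Order.height p = c ∧ p ∉ X) →
      ∃ p q P : PrimeSpectrum R, (J ≤ p.asIdeal ∧ Order.height p = c ∧ p ∈ X) ∧
        (J ≤ q.asIdeal ∧ Order.height q = c ∧ q ∉ X) ∧ p ≤ P ∧ q ≤ P ∧
        Order.height P = (c + 1 : ℕ))
    {e : Module.End R (ExtR R c (R ⧸ J))} (he : e * e = e) : e = 0 ∨ e = 1 := by
  by_contra! hne
  have he' : ∀ y, e (e y) = e y := fun y => DFunLike.congr_fun he y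
  let X : Set (PrimeSpectrum R) := {p | ∃ z, (∀ a ∈ p.asIdeal, a • z = 0) ∧ e z ≠ 0}
  have hX (p : PrimeSpectrum R) (hp : p ∉ X) (z : ExtR R c (R ⧸ J))
      (hz : ∀ a ∈ p.asIdeal, a • z = 0) : e z = 0 := by
    by_contra h
    exact hp ⟨z, hz, h⟩
  have ne_zero {p : PrimeSpectrum R} {z : ExtR R c (R ⧸ J)}
      (h : ∀ a, a ∈ p.asIdeal ↔ a • z = 0) : z ≠ 0 := fun h0 =>
    p.isPrime.ne_top ((Ideal.eq_top_iff_one _).mpr ((h 1).mpr (by rw [h0, smul_zero])))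
  obtain ⟨p, q, P, ⟨hJp, hp, hpX⟩, ⟨hJq, hq, hqX⟩, hpP, hqP, hP⟩ := hconn X (by
    obtain ⟨y, hy⟩ : ∃ y, e y ≠ 0 := by
      by_contra! h
      exact hne.1 (LinearMap.ext h)
    obtain ⟨p, r, ⟨hJp, hp⟩, hann⟩ := hR.exists_prime_annihilator_ext hJ hy
    refine ⟨p, hJp, hp, r • e y, fun a ha => (hann a).mp ha, ?_⟩
    rw [map_smul, he']
    exact ne_zero hann) (by
    obtain ⟨y, hy⟩ : ∃ y, y - e y ≠ 0 := by
      by_contra! h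
      exact hne.2 (LinearMap.ext fun y => (sub_eq_zero.mp (h y)).symm)
    obtain ⟨p, r, ⟨hJp, hp⟩, hann⟩ := hR.exists_prime_annihilator_ext hJ hy
    refine ⟨p, hJp, hp, fun hpX => ne_zero hann ?_⟩
    rw [← hR.idempotent_apply_eq hJ hp he' hpX fun a ha => (hann a).mp ha, map_smul, map_sub, he',
      sub_self, smul_zero])
  refine hR.height_ne_of_forall_exists_add hJ hp hq (fun h => hqX (h ▸ hpX)) hJp hJq hpP hqP
    (fun z hz => ⟨e z, z - e z, by abel, fun a ha => ?_, fun b hb => ?_⟩) hP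
  · rw [← map_smul, ← he', map_smul]
    refine hX q hqX _ fun b hb => ?_
    rw [← map_smul, ← map_smul, smul_smul, hz _ ⟨?_, ?_⟩, map_zero]
    · exact Ideal.mul_mem_left _ _ ha
    · exact Ideal.mul_mem_right _ _ hb
  · have h1 : e (b • (z - e z)) = b • (z - e z) :=
      hR.idempotent_apply_eq hJ hp he' hpX fun a ha => by
        rw [smul_smul, smul_sub, ← map_smul, hz _ ⟨Ideal.mul_mem_right _ _ ha,
          Ideal.mul_mem_left _ _ hb⟩, map_zero, sub_zero]
    rw [← h1, map_smul, map_sub, he', sub_self, smul_zero]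

end IsGorensteinOfDim
end Endomorphisms

section Complete

theorem isPrecomplete_of_finite {R : Type*} [CommRing R] (I : Ideal R) [IsPrecomplete I R]
    (M : Type*) [AddCommGroup M] [Module R M] [Module.Finite R M] : IsPrecomplete I M := by
  rw [← AdicCompletion.of_surjective_iff]
  intro y
  obtain ⟨t, rfl⟩ := AdicCompletion.ofTensorProduct_surjective_of_finite I M y
  induction t with
  | zero => exact ⟨0, by simp⟩
  | tmul a m =>
    obtain ⟨r, rfl⟩ := AdicCompletion.of_surjective_iff.mpr ‹IsPrecomplete I R› a
    refine ⟨r • m, ?_⟩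
    rw [AdicCompletion.ofTensorProduct_tmul, map_smul]
    rfl
  | add s t hs ht =>
    obtain ⟨x, hx⟩ := hs
    obtain ⟨y, hy⟩ := ht
    exact ⟨x + y, by rw [map_add, map_add, hx, hy]⟩

theorem isAdicComplete_map_of_finite {R : Type*} [CommRing R] [IsLocalRing R] [IsNoetherianRing R]
    [IsAdicComplete (maximalIdeal R) R] (S : Type*) [CommRing S] [Algebra R S]
    [Module.Finite R S] : IsAdicComplete ((maximalIdeal R).map (algebraMap R S)) S := by
  have h1 := isPrecomplete_of_finite (maximalIdeal R) S
  have h2 : IsHausdorff (maximalIdeal R) S := inferInstance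
  exact { toIsHausdorff := IsHausdorff.map_algebraMap_iff.mpr h2
          toIsPrecomplete := IsPrecomplete.map_algebraMap_iff.mpr h1 }

theorem exists_idempotent_sub_mem {S : Type*} [CommRing S] (I : Ideal S) [HenselianRing S I] {a : S}
    (ha : a * a - a ∈ I) : ∃ e : S, e * e = e ∧ e - a ∈ I := by
  have hmonic : (Polynomial.X ^ 2 - Polynomial.X : Polynomial S).Monic :=
    Polynomial.monic_X_pow_sub (lt_of_le_of_lt Polynomial.degree_X_le (by norm_num))
  obtain ⟨e, he, hea⟩ := HenselianRing.is_henselian (I := I)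
    (Polynomial.X ^ 2 - Polynomial.X) hmonic a (by simpa [sq] using ha) (by
      refine IsUnit.of_mul_eq_one (Ideal.Quotient.mk I (2 * a - 1)) ?_
      rw [← map_mul, ← map_one (Ideal.Quotient.mk I), Ideal.Quotient.mk_eq_mk_iff_sub_mem]
      simp only [Polynomial.derivative_sub, Polynomial.derivative_X_pow, Polynomial.derivative_X,
        Polynomial.eval_sub, Polynomial.eval_mul, Polynomial.eval_pow, Polynomial.eval_X,
        Polynomial.eval_one, Polynomial.eval_C]
      convert Ideal.mul_mem_left I 4 ha using 1
      push_cast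
      ring)
  refine ⟨e, ?_, hea⟩
  simpa [sq, sub_eq_zero] using he

theorem isArtinianRing_quotient_map {R : Type*} [CommRing R] [IsLocalRing R]
    (S : Type*) [CommRing S] [Algebra R S] [Module.Finite R S] :
    IsArtinianRing (S ⧸ (maximalIdeal R).map (algebraMap R S)) := by
  let := Ideal.Quotient.algebraQuotientOfLEComap (R := R) (A := S) (p := maximalIdeal R)
    (P := (maximalIdeal R).map (algebraMap R S)) Ideal.le_comap_map
  have : Module.Finite (R ⧸ maximalIdeal R) (S ⧸ (maximalIdeal R).map (algebraMap R S)) :=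
    Module.Finite.of_restrictScalars_finite R _ _
  have : IsArtinianRing (R ⧸ maximalIdeal R) :=
    let := Ideal.Quotient.field (maximalIdeal R)
    inferInstance
  exact IsArtinianRing.of_finite (R ⧸ maximalIdeal R) _

theorem isUnit_or_isUnit_one_sub_of_algebra {R : Type*} [CommRing R] [IsLocalRing R] [IsNoetherianRing R]
    [IsAdicComplete (maximalIdeal R) R] {S : Type*} [CommRing S] [Algebra R S]
    [Module.Finite R S] {E : Type*} [Ring E] (φ : S →+* E)
    (hE : ∀ e : E, e * e = e → e = 0 ∨ e = 1) (x : S) : IsUnit (φ x) ∨ IsUnit (1 - φ x) := by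
  have := isAdicComplete_map_of_finite (R := R) S
  have := isArtinianRing_quotient_map (R := R) S
  set I := (maximalIdeal R).map (algebraMap R S)
  have hI : ∀ y ∈ I, IsUnit (1 + y) := fun y hy => by
    have := Ideal.mem_jacobson_bot.mp (IsAdicComplete.le_jacobson_bot I hy) 1
    rwa [mul_one, add_comm] at this
  obtain ⟨k, y, hy⟩ := IsArtinian.exists_pow_succ_smul_dvd (Ideal.Quotient.mk I x)
    (1 : S ⧸ I)
  obtain ⟨y, rfl⟩ := Ideal.Quotient.mk_surjective y
  have hk : (Ideal.Quotient.mk I x) ^ (k + 1) * (Ideal.Quotient.mk I (x * y)) ^ (k + 1) =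
      (Ideal.Quotient.mk I x) ^ (k + 1) := by
    have h (j : ℕ) : (Ideal.Quotient.mk I x) ^ k * (Ideal.Quotient.mk I (x * y)) ^ j =
        (Ideal.Quotient.mk I x) ^ k := by
      rw [smul_eq_mul, smul_eq_mul, mul_one] at hy
      induction j with
      | zero => simp
      | succ j ih =>
        rw [pow_succ, ← mul_assoc, ih, map_mul, ← mul_assoc, ← pow_succ, hy]
    rw [pow_succ', mul_assoc, h]
  obtain ⟨e, he, hea⟩ := exists_idempotent_sub_mem I (a := x ^ (k + 1) * y ^ (k + 1)) (by
    rw [← Ideal.Quotient.eq_zero_iff_mem, map_sub, sub_eq_zero, ← mul_pow, ← mul_pow]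
    simp only [map_mul, map_pow, mul_pow] at hk ⊢
    linear_combination (Ideal.Quotient.mk I y) ^ (k + 1) * hk)
  obtain h0 | h1 := hE (φ e) (by rw [← map_mul, he])
  · right
    have hmem : -(x ^ (k + 1) * (1 - e)) ∈ I := by
      rw [← Ideal.Quotient.eq_zero_iff_mem] at hea ⊢
      simp only [map_mul, map_pow, map_sub, map_neg, map_one, mul_pow] at hk hea ⊢
      linear_combination (Ideal.Quotient.mk I x) ^ (k + 1) * hea + hk
    have hu := (hI _ hmem).map φ
    have h2 : φ (1 + -(x ^ (k + 1) * (1 - e))) = 1 - φ x ^ (k + 1) := by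
      simp [h0, sub_eq_add_neg]
    rw [h2, ← mul_neg_geom_sum] at hu
    refine (Commute.isUnit_mul_iff (Commute.sum_right _ _ _ fun i _ => ?_)).mp hu |>.1
    exact (Commute.sub_left (Commute.one_left _) (Commute.refl _)).pow_right i
  · left
    have hu := (hI _ (neg_mem hea)).map φ
    have h2 : φ (1 + -(e - x ^ (k + 1) * y ^ (k + 1))) = φ x * φ (x ^ k * y ^ (k + 1)) := by
      simp [h1, pow_succ', mul_assoc]
    rw [h2] at hu
    refine (Commute.isUnit_mul_iff ?_).mp hu |>.1
    rw [commute_iff_eq, ← map_mul, ← map_mul, mul_comm]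

theorem isUnit_or_isUnit_one_sub_of_finite {R : Type*} [CommRing R] [IsLocalRing R] [IsNoetherianRing R]
    [IsAdicComplete (maximalIdeal R) R] {M : Type*} [AddCommGroup M] [Module R M]
    [Module.Finite R M] (hE : ∀ e : Module.End R M, e * e = e → e = 0 ∨ e = 1)
    (f : Module.End R M) : IsUnit f ∨ IsUnit (1 - f) := by
  obtain ⟨p, hp, hpf⟩ := LinearMap.exists_monic_and_aeval_eq_zero R f
  have := hp.finite_adjoinRoot
  let φ : AdjoinRoot p →+* Module.End R M := Ideal.Quotient.lift (Ideal.span {p})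
    (Polynomial.aeval f).toRingHom (fun a ha => by
      obtain ⟨b, rfl⟩ := Ideal.mem_span_singleton.mp ha
      simp [hpf])
  have hφ : φ (AdjoinRoot.root p) = f := Polynomial.aeval_X f
  simpa [hφ] using isUnit_or_isUnit_one_sub_of_algebra (R := R) φ hE (AdjoinRoot.root p)

end Complete

section HomologyClass

variable {R : Type u} [CommRing R]

/-- The linear map from the kernel of a differential to the object of cycles. -/
def kerToCycles (E : CochainComplex (ModuleCat.{u} R) ℕ) (n : ℕ) :
    LinearMap.ker (E.d n (n + 1)).hom →ₗ[R] E.cycles n :=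
  (E.liftCycles (ModuleCat.ofHom (LinearMap.ker (E.d n (n + 1)).hom).subtype) (n + 1) (by simp)
    (by ext x; exact x.2)).hom

theorem iCycles_kerToCycles (E : CochainComplex (ModuleCat.{u} R) ℕ) (n : ℕ)
    (x : LinearMap.ker (E.d n (n + 1)).hom) : (E.iCycles n).hom (kerToCycles E n x) = x := by
  have h := E.liftCycles_i (ModuleCat.ofHom (LinearMap.ker (E.d n (n + 1)).hom).subtype) (n + 1)
    (by simp) (by ext x; exact x.2)
  exact congr($(h).hom x)

theorem iCycles_injective (E : CochainComplex (ModuleCat.{u} R) ℕ) (n : ℕ) :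
    Function.Injective (E.iCycles n).hom :=
  (ModuleCat.mono_iff_injective (E.iCycles n)).mp inferInstance

/-- The class in homology of a cocycle. -/
def homologyClass (E : CochainComplex (ModuleCat.{u} R) ℕ) (n : ℕ) :
    LinearMap.ker (E.d n (n + 1)).hom →ₗ[R] E.homology n :=
  (E.homologyπ n).hom ∘ₗ kerToCycles E n

theorem homologyClass_surjective (E : CochainComplex (ModuleCat.{u} R) ℕ) (n : ℕ) :
    Function.Surjective (homologyClass E n) := by
  intro y
  obtain ⟨z, rfl⟩ := (ModuleCat.epi_iff_surjective (E.homologyπ n)).mp inferInstance y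
  have hz : (E.iCycles n).hom z ∈ LinearMap.ker (E.d n (n + 1)).hom :=
    congr($(E.iCycles_d n (n + 1)).hom z)
  exact ⟨⟨_, hz⟩, congr_arg (E.homologyπ n).hom
    (iCycles_injective E n (iCycles_kerToCycles E n ⟨_, hz⟩))⟩

theorem homologyClass_eq_zero_iff (E : CochainComplex (ModuleCat.{u} R) ℕ) (n : ℕ)
    (x : LinearMap.ker (E.d n (n + 1)).hom) :
    homologyClass E n x = 0 ↔
      ∃ y, (E.d ((ComplexShape.up ℕ).prev n) n).hom y = (x : E.X n) := by
  have hex := (ShortComplex.exact_of_g_is_cokernel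
    (ShortComplex.mk _ _ (E.toCycles_comp_homologyπ ((ComplexShape.up ℕ).prev n) n))
    (E.homologyIsCokernel _ n rfl))
  rw [ShortComplex.moduleCat_exact_iff] at hex
  have hd : ∀ y, (E.iCycles n).hom ((E.toCycles ((ComplexShape.up ℕ).prev n) n).hom y) =
      (E.d ((ComplexShape.up ℕ).prev n) n).hom y :=
    fun y => congr($(E.toCycles_i ((ComplexShape.up ℕ).prev n) n).hom y)
  constructor
  · intro h
    obtain ⟨y, hy⟩ := hex _ h
    exact ⟨y, ((hd y).symm.trans (congr_arg (E.iCycles n).hom hy)).trans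
      (iCycles_kerToCycles E n x)⟩
  · rintro ⟨y, hy⟩
    have h : kerToCycles E n x = (E.toCycles ((ComplexShape.up ℕ).prev n) n).hom y := by
      apply iCycles_injective
      rw [iCycles_kerToCycles, hd, hy]
    rw [homologyClass, LinearMap.comp_apply, h]
    exact congr($(E.toCycles_comp_homologyπ ((ComplexShape.up ℕ).prev n) n).hom y)

theorem homologyMap_homologyClass {E E' : CochainComplex (ModuleCat.{u} R) ℕ} (φ : E ⟶ E') (n : ℕ)
    (x : LinearMap.ker (E.d n (n + 1)).hom) (x' : LinearMap.ker (E'.d n (n + 1)).hom)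
    (hx : (φ.f n).hom (x : E.X n) = x') :
    (HomologicalComplex.homologyMap φ n).hom (homologyClass E n x) = homologyClass E' n x' := by
  have h : (HomologicalComplex.cyclesMap φ n).hom (kerToCycles E n x) = kerToCycles E' n x' := by
    apply iCycles_injective
    rw [iCycles_kerToCycles, ← hx, ← iCycles_kerToCycles E n x]
    exact congr($(HomologicalComplex.cyclesMap_i φ n).hom (kerToCycles E n x))
  rw [homologyClass, homologyClass, LinearMap.comp_apply, LinearMap.comp_apply, ← h]
  exact congr($(HomologicalComplex.homologyπ_naturality φ n).hom (kerToCycles E n x))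

end HomologyClass

section ExtComparison

theorem inv_comp_eq_of_comp_hom_eq {C : Type*} [Category* C] {A A' B B' : C} (i : A ≅ B)
    (j : A' ≅ B') {a : A ⟶ A'} {b : B ⟶ B'} (h : a ≫ j.hom = i.hom ≫ b) :
    i.inv ≫ a = b ≫ j.inv := by
  rw [Iso.inv_comp_eq, ← Category.assoc, ← h, Category.assoc, Iso.hom_inv_id, Category.comp_id]

namespace CategoryTheory.ProjectiveResolution

variable {R : Type u} [CommRing R] {X X' : ModuleCat.{u} R} {P : ProjectiveResolution X}
  {P' : ProjectiveResolution X'}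

/-- The map of cochain complexes `Hom(P', Y) ⟶ Hom(P, Y)` induced by `P ⟶ P'`. -/
def linearYonedaMap (φ : P.complex ⟶ P'.complex) (Y : ModuleCat.{u} R) :
    P'.complex.linearYonedaObj R Y ⟶ P.complex.linearYonedaObj R Y :=
  (HomologicalComplex.unopFunctor _ _).map
    ((((linearYoneda R _).obj Y).rightOp.mapHomologicalComplex _).map φ).op

theorem isoExt_hom_naturality {f : X ⟶ X'} (φ : Hom P P' f) (n : ℕ) (Y : ModuleCat.{u} R) :
    ((Ext R (ModuleCat.{u} R) n).map f.op).app Y ≫ (P.isoExt n Y).hom =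
      (P'.isoExt n Y).hom ≫ HomologicalComplex.homologyMap (linearYonedaMap φ.hom Y) n := by
  have h1 := isoLeftDerivedObj_inv_naturality f P P' φ.hom
    (by simpa using φ.hom_f_zero_comp_π_f_zero)
    ((linearYoneda R (ModuleCat.{u} R)).obj Y).rightOp n
  have h2 := HomologicalComplex.homologyOp_hom_naturality (linearYonedaMap φ.hom Y) n
  have h3 : (((P.complex.linearYonedaObj R Y).homologyOp n).inv ≫
      HomologicalComplex.homologyMap ((HomologicalComplex.opFunctor _ _).map
        (linearYonedaMap φ.hom Y).op) n) =
      (HomologicalComplex.homologyMap (linearYonedaMap φ.hom Y) n).op ≫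
        ((P'.complex.linearYonedaObj R Y).homologyOp n).inv :=
    inv_comp_eq_of_comp_hom_eq _ _ h2
  have h4 := congr_arg (fun t => ((P.complex.linearYonedaObj R Y).homologyOp n).inv ≫ t) h1
  have h5 := congr_arg (fun t => t ≫ (P'.isoLeftDerivedObj
    ((linearYoneda R (ModuleCat.{u} R)).obj Y).rightOp n).inv) h3
  have h6 := h4.trans ((Category.assoc _ _ _).symm.trans h5)
  have h7 := congr_arg Quiver.Hom.unop h6
  exact (Category.assoc _ _ _).symm.trans (h7.trans (Category.assoc _ _ _).symm)

theorem extMk_degree_zero_eq_zero_iff {Y : ModuleCat.{u} R} (f : P.complex.X 0 ⟶ Y)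
    (hf : P.complex.d 1 0 ≫ f = 0) : P.extMk f 1 rfl hf = 0 ↔ f = 0 := by
  refine ⟨fun h => ?_, fun h => by subst h; simp⟩
  simp only [← P.extEquivCohomologyClass.apply_eq_iff_eq,
    extEquivCohomologyClass_extMk, extEquivCohomologyClass_zero,
    CochainComplex.HomComplex.CohomologyClass.mk_eq_zero_iff] at h
  rw [CochainComplex.HomComplex.Cocycle.toSingleMk_mem_coboundaries_iff _ _ _ _ _ 1 (by lia)] at h
  obtain ⟨g, hg⟩ := h
  have h0 : P.cochainComplex.d (-((0 : ℕ) : ℤ)) 1 = 0 :=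
    (CochainComplex.isZero_of_isStrictlyLE _ 0 _ (by lia)).eq_of_tgt _ _
  rw [h0, zero_comp] at hg
  rw [← cancel_epi (P.cochainComplexXIso (-((0 : ℕ) : ℤ)) 0 rfl).hom, ← hg, comp_zero]

/-- The morphism underlying a cocycle. -/
def cocycleHom {n : ℕ} {Y : ModuleCat.{u} R}
    (x : LinearMap.ker ((P.complex.linearYonedaObj R Y).d n (n + 1)).hom) : P.complex.X n ⟶ Y :=
  x.1

theorem d_comp_cocycleHom {n : ℕ} {Y : ModuleCat.{u} R}
    (x : LinearMap.ker ((P.complex.linearYonedaObj R Y).d n (n + 1)).hom) :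
    P.complex.d (n + 1) n ≫ cocycleHom x = 0 :=
  x.2

/-- The class in `Ext` of a cocycle. -/
def extClass (P : ProjectiveResolution X) (n : ℕ) (Y : ModuleCat.{u} R) :
    LinearMap.ker ((P.complex.linearYonedaObj R Y).d n (n + 1)).hom →ₗ[R] Abelian.Ext X Y n where
  toFun x := P.extMk (cocycleHom x) (n + 1) rfl (d_comp_cocycleHom x)
  map_add' x y := (P.add_extMk _ _ _ _ _ _).symm
  map_smul' r x := by
    rw [RingHom.id_apply, Abelian.Ext.smul_eq_comp_mk₀, extMk_comp_mk₀]
    congr 1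

theorem extClass_surjective (P : ProjectiveResolution X) (n : ℕ) (Y : ModuleCat.{u} R) :
    Function.Surjective (P.extClass n Y) := by
  intro y
  obtain ⟨f, hf, rfl⟩ := P.extMk_surjective y (n + 1) rfl
  exact ⟨⟨f, hf⟩, rfl⟩

theorem extClass_eq_zero_iff (P : ProjectiveResolution X) (n : ℕ) (Y : ModuleCat.{u} R)
    (x : LinearMap.ker ((P.complex.linearYonedaObj R Y).d n (n + 1)).hom) :
    P.extClass n Y x = 0 ↔ homologyClass _ n x = 0 := by
  rw [homologyClass_eq_zero_iff]
  cases n with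
  | zero =>
    refine (extMk_degree_zero_eq_zero_iff (cocycleHom x) (d_comp_cocycleHom x)).trans ?_
    rw [HomologicalComplex.shape _ _ _ (by simp)]
    exact ⟨fun h => ⟨0, h.symm⟩, fun ⟨_, h⟩ => h.symm⟩
  | succ n =>
    refine (P.extMk_eq_zero_iff (cocycleHom x) (n + 1 + 1) rfl (d_comp_cocycleHom x) n rfl).trans ?_
    rw [CochainComplex.prev_nat_succ]
    rfl

/-- Mathlib's two versions of `Ext` agree. -/
def extIso (P : ProjectiveResolution X) (n : ℕ) (Y : ModuleCat.{u} R) :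
    ((Ext R (ModuleCat.{u} R) n).obj (op X)).obj Y ≃ₗ[R] Abelian.Ext X Y n :=
  (P.isoExt n Y).toLinearEquiv ≪≫ₗ
    ((homologyClass (P.complex.linearYonedaObj R Y) n).quotKerEquivOfSurjective
      (homologyClass_surjective _ n)).symm ≪≫ₗ
    Submodule.quotEquivOfEq _ _ (by
      ext x
      exact (P.extClass_eq_zero_iff n Y x).symm) ≪≫ₗ
    (P.extClass n Y).quotKerEquivOfSurjective (P.extClass_surjective n Y)

theorem extIso_eq (P : ProjectiveResolution X) (n : ℕ) (Y : ModuleCat.{u} R)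
    (y : ((Ext R (ModuleCat.{u} R) n).obj (op X)).obj Y)
    (x : LinearMap.ker ((P.complex.linearYonedaObj R Y).d n (n + 1)).hom)
    (h : (P.isoExt n Y).hom.hom y = homologyClass _ n x) : P.extIso n Y y = P.extClass n Y x := by
  have h' : ((homologyClass (P.complex.linearYonedaObj R Y) n).quotKerEquivOfSurjective
      (homologyClass_surjective _ n)).symm ((P.isoExt n Y).toLinearEquiv y) =
      Submodule.Quotient.mk x := by
    rw [LinearEquiv.symm_apply_eq]
    exact h
  rw [extIso, LinearEquiv.trans_apply, LinearEquiv.trans_apply, LinearEquiv.trans_apply, h']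
  rfl

theorem extIso_naturality {f : X ⟶ X'} (φ : Hom P P' f) (n : ℕ) (Y : ModuleCat.{u} R)
    (y : ((Ext R (ModuleCat.{u} R) n).obj (op X')).obj Y) :
    P.extIso n Y ((((Ext R (ModuleCat.{u} R) n).map f.op).app Y).hom y) =
      (Abelian.Ext.mk₀ f).comp (P'.extIso n Y y) (zero_add n) := by
  obtain ⟨x, hx⟩ := homologyClass_surjective _ n ((P'.isoExt n Y).hom.hom y)
  have hx' : ((linearYonedaMap φ.hom Y).f n).hom x ∈
      LinearMap.ker ((P.complex.linearYonedaObj R Y).d n (n + 1)).hom := by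
    change P.complex.d (n + 1) n ≫ φ.hom.f n ≫ cocycleHom x = 0
    rw [← HomologicalComplex.Hom.comm_assoc, d_comp_cocycleHom, comp_zero]
  rw [P'.extIso_eq n Y y x hx.symm, P.extIso_eq n Y _ ⟨_, hx'⟩]
  · exact (mk₀_comp_extMk (cocycleHom x) (n + 1) rfl (d_comp_cocycleHom x) φ).symm
  · rw [← homologyMap_homologyClass (linearYonedaMap φ.hom Y) n x _ rfl, hx]
    exact congr($(isoExt_hom_naturality φ n Y).hom y)

end CategoryTheory.ProjectiveResolution

variable {R : Type u} [CommRing R]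

/-- The comparison between Mathlib's two versions of `Ext^i(-, R)`. -/
def extMEquiv (i : ℕ) (N : Type u) [AddCommGroup N] [Module R N] :
    ExtM R i (ModuleCat.of R N) (ModuleCat.of R R) ≃ₗ[R] ExtR R i N :=
  (ProjectiveResolution.of (ModuleCat.of R N)).extIso i (ModuleCat.of R R)

theorem extMEquiv_map (i : ℕ) {N N' : Type u} [AddCommGroup N] [Module R N] [AddCommGroup N']
    [Module R N'] (f : N →ₗ[R] N') (y : ExtM R i (ModuleCat.of R N') (ModuleCat.of R R)) :
    extMEquiv i N ((((Ext R (ModuleCat.{u} R) i).map (ModuleCat.ofHom f).op).app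
      (ModuleCat.of R R)).hom y) = ExtR.map i f (extMEquiv i N' y) :=
  ProjectiveResolution.extIso_naturality
    ⟨ProjectiveResolution.lift (ModuleCat.ofHom f) _ _,
      by simpa using ProjectiveResolution.lift_commutes_zero _ _ _⟩ i _ y

end ExtComparison

section LocalCohomology

open localCohomology

variable {R : Type u} [CommRing R]

/-- The canonical map from Mathlib's `Ext^i(R/I^α, R)` to `H^i_I(R)`. -/
def extMToLC (I : Ideal R) (i α : ℕ) :
    ExtM R i (ModuleCat.of R (R ⧸ I ^ α)) (ModuleCat.of R R) ⟶ LC R I i (ModuleCat.of R R) :=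
  (colimit.ι (diagram (idealPowersDiagram I) i) (op (op α))).app (ModuleCat.of R R)

/-- The canonical map `Ext^i(R/I^α, R) → H^i_I(R)`. -/
def toLC (I : Ideal R) (i α : ℕ) : ExtR R i (R ⧸ I ^ α) →ₗ[R] LC R I i (ModuleCat.of R R) :=
  (extMToLC I i α).hom ∘ₗ (extMEquiv i (R ⧸ I ^ α)).symm.toLinearMap

theorem toLC_apply (I : Ideal R) (i α : ℕ) (x : ExtR R i (R ⧸ I ^ α)) :
    toLC I i α x = (extMToLC I i α).hom ((extMEquiv i (R ⧸ I ^ α)).symm x) := rfl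

theorem extMEquiv_symm_map (i : ℕ) {N N' : Type u} [AddCommGroup N] [Module R N] [AddCommGroup N']
    [Module R N'] (f : N →ₗ[R] N') (y : ExtR R i N') :
    (((Ext R (ModuleCat.{u} R) i).map (ModuleCat.ofHom f).op).app
      (ModuleCat.of R R)).hom ((extMEquiv i N').symm y) =
      (extMEquiv i N).symm (ExtR.map i f y) := by
  rw [LinearEquiv.eq_symm_apply, extMEquiv_map, LinearEquiv.apply_symm_apply]

/-- The projection `R/I^β → R/I^α` for `α ≤ β`. -/
def quotPowMap (I : Ideal R) {α β : ℕ} (h : α ≤ β) : (R ⧸ I ^ β) →ₗ[R] (R ⧸ I ^ α) :=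
  Submodule.mapQ _ _ LinearMap.id (Ideal.pow_le_pow_right h)

theorem diagram_map_extMEquiv_symm (I : Ideal R) (i : ℕ) {α β : ℕ} (h : α ≤ β)
    (x : ExtR R i (R ⧸ I ^ α)) :
    (((diagram (idealPowersDiagram I) i).map (homOfLE h).op.op).app (ModuleCat.of R R)).hom
      ((extMEquiv i (R ⧸ I ^ α)).symm x) =
    (extMEquiv i (R ⧸ I ^ β)).symm (ExtR.map i (quotPowMap I h) x) :=
  extMEquiv_symm_map i (quotPowMap I h) x

theorem toLC_map (I : Ideal R) (i : ℕ) {α β : ℕ} (h : α ≤ β) (x : ExtR R i (R ⧸ I ^ α)) :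
    toLC I i β (ExtR.map i (quotPowMap I h) x) = toLC I i α x := by
  have h1 := congr_app (colimit.w (diagram (idealPowersDiagram I) i) (homOfLE h).op.op)
    (ModuleCat.of R R)
  rw [toLC_apply, ← diagram_map_extMEquiv_symm]
  exact congr($(h1).hom _)

/-- Evaluating at `R` the colimit defining local cohomology gives a colimit. -/
def isColimitLC (I : Ideal R) (i : ℕ) :
    IsColimit (((evaluation _ _).obj (ModuleCat.of R R)).mapCocone
      (colimit.cocone (diagram (idealPowersDiagram I) i))) :=
  isColimitOfPreserves _ (colimit.isColimit _)

instance : PreservesFilteredColimitsOfSize.{0, 0} (forget (ModuleCat.{u} R)) :=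
  have := ModuleCat.FilteredColimits.forget_preservesFilteredColimits (R := R)
  preservesFilteredColimitsOfSize_shrink.{0, u, 0, u} (forget (ModuleCat.{u} R))

theorem exists_map_eq_zero_of_isColimit {F : (ℕᵒᵖ)ᵒᵖ ⥤ ModuleCat.{u} R} {t : Cocone F}
    (ht : IsColimit t) {j : (ℕᵒᵖ)ᵒᵖ} (x : F.obj j) (hx : (t.ι.app j).hom x = 0) :
    ∃ (k : (ℕᵒᵖ)ᵒᵖ) (f : j ⟶ k), (F.map f).hom x = 0 := by
  obtain ⟨k, f, h⟩ := (IsColimit.eq_iff' ht x 0).mp (hx.trans (map_zero (t.ι.app j).hom).symm)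
  exact ⟨k, f, h.trans (map_zero (F.map f).hom)⟩

theorem exists_toLC_eq (I : Ideal R) (i : ℕ) (y : LC R I i (ModuleCat.of R R)) :
    ∃ α x, toLC I i α x = y := by
  obtain ⟨⟨⟨α⟩⟩, x, hx⟩ := Concrete.isColimit_exists_rep _ (isColimitLC I i) y
  let x' : ExtM R i (ModuleCat.of R (R ⧸ I ^ α)) (ModuleCat.of R R) := x
  refine ⟨α, extMEquiv i _ x', ?_⟩
  rw [toLC_apply, LinearEquiv.symm_apply_apply]
  exact hx

theorem exists_map_eq_zero_of_toLC_eq_zero (I : Ideal R) (i : ℕ) {α : ℕ}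
    {x : ExtR R i (R ⧸ I ^ α)} (hx : toLC I i α x = 0) :
    ∃ β, ∃ h : α ≤ β, ExtR.map i (quotPowMap I h) x = 0 := by
  obtain ⟨⟨⟨β⟩⟩, f, h⟩ := exists_map_eq_zero_of_isColimit (isColimitLC I i) (j := op (op α))
    ((extMEquiv i (R ⧸ I ^ α)).symm x) hx
  have hαβ : α ≤ β := leOfHom f.unop.unop
  refine ⟨β, hαβ, (extMEquiv i (R ⧸ I ^ β)).symm.injective ?_⟩
  rw [map_zero]
  exact (diagram_map_extMEquiv_symm I i hαβ x).symm.trans h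

end LocalCohomology

section Gluing

/-- If every element of a module is killed by some power of an ideal, endomorphisms are determined
by their restrictions to the submodules of elements killed by a fixed power. -/
theorem end_mul_comm_of_torsionBySet {R H : Type*} [CommRing R] [AddCommGroup H] [Module R H]
    {I : Ideal R} (hH : ∀ x : H, ∃ α : ℕ, ∀ a ∈ I ^ (α + 1), a • x = 0)
    (hcomm : ∀ (α : ℕ) (f g : Module.End R (Submodule.torsionBySet R H (I ^ (α + 1) : Ideal R))),
      f * g = g * f) (f g : Module.End R H) : f * g = g * f := by
  ext x
  obtain ⟨α, hα⟩ := hH x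
  have hinv : ∀ f : Module.End R H, ∀ x ∈ Submodule.torsionBySet R H (I ^ (α + 1) : Ideal R),
      f x ∈ Submodule.torsionBySet R H (I ^ (α + 1) : Ideal R) := fun f x hx => by
    rw [Submodule.mem_torsionBySet_iff] at hx ⊢
    intro a
    rw [← map_smul, hx a, map_zero]
  have hx : x ∈ Submodule.torsionBySet R H (I ^ (α + 1) : Ideal R) := by
    rw [Submodule.mem_torsionBySet_iff]
    exact fun a => hα a a.2
  exact congrArg Subtype.val
    (DFunLike.congr_fun (hcomm α (f.restrict (hinv f)) (g.restrict (hinv g))) ⟨x, hx⟩)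

theorem isUnit_or_isUnit_one_sub_of_torsionBySet {R H : Type*} [CommRing R] [AddCommGroup H]
    [Module R H] {I : Ideal R} (hH : ∀ x : H, ∃ α : ℕ, ∀ a ∈ I ^ (α + 1), a • x = 0)
    (hloc : ∀ (α : ℕ) (f : Module.End R (Submodule.torsionBySet R H (I ^ (α + 1) : Ideal R))),
      IsUnit f ∨ IsUnit (1 - f)) (f : Module.End R H) : IsUnit f ∨ IsUnit (1 - f) := by
  let U : ℕ → Submodule R H := fun α => Submodule.torsionBySet R H (I ^ (α + 1) : Ideal R)
  have hU : ∀ α x, x ∈ U α ↔ ∀ a ∈ I ^ (α + 1), a • x = 0 := fun α x => by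
    simp [U, Submodule.mem_torsionBySet_iff]
  have hinv : ∀ (f : Module.End R H) α, ∀ x ∈ U α, f x ∈ U α := fun f α x hx => by
    rw [hU] at hx ⊢
    intro a ha
    rw [← map_smul, hx a ha, map_zero]
  have hmono : Monotone U := fun α β h x hx => by
    rw [hU] at hx ⊢
    exact fun a ha => hx a (Ideal.pow_le_pow_right (Nat.succ_le_succ h) ha)
  have key : ∀ f : Module.End R H, (∀ α, ∃ β, α ≤ β ∧ IsUnit (f.restrict (hinv f β))) →
      IsUnit f := by
    intro f hf
    rw [Module.End.isUnit_iff]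
    constructor
    · rw [injective_iff_map_eq_zero]
      intro x hx
      obtain ⟨α, hα⟩ := hH x
      obtain ⟨β, hαβ, hβ⟩ := hf α
      have := ((Module.End.isUnit_iff _).mp hβ).1
        (a₁ := ⟨x, hmono hαβ ((hU α x).mpr hα)⟩) (a₂ := 0) (Subtype.ext (by simpa using hx))
      exact congrArg Subtype.val this
    · intro x
      obtain ⟨α, hα⟩ := hH x
      obtain ⟨β, hαβ, hβ⟩ := hf α
      obtain ⟨y, hy⟩ := ((Module.End.isUnit_iff _).mp hβ).2 ⟨x, hmono hαβ ((hU α x).mpr hα)⟩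
      exact ⟨y, congrArg Subtype.val hy⟩
  by_contra! h
  obtain ⟨α, hα⟩ := not_forall.mp (mt (key f) h.1)
  obtain ⟨β, hβ⟩ := not_forall.mp (mt (key (1 - f)) h.2)
  push Not at hα hβ
  rcases hloc (max α β) (f.restrict (hinv f _)) with h' | h'
  · exact hα _ (le_max_left _ _) h'
  · exact hβ _ (le_max_right _ _) h'

namespace IsGorensteinOfDim

variable {R : Type u} [CommRing R] [IsLocalRing R] {n : ℕ} (hR : IsGorensteinOfDim R n)
  {I : Ideal R} {c : ℕ} (hI : ∀ p : PrimeSpectrum R, I ≤ p.asIdeal → c ≤ Order.height p)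

include hI in
omit [IsLocalRing R] in
theorem le_height_of_pow_le (α : ℕ) (p : PrimeSpectrum R) (hp : I ^ α ≤ p.asIdeal) :
    c ≤ Order.height p :=
  hI p (Ideal.IsPrime.le_of_pow_le hp)

include hR hI

theorem toLC_injective (α : ℕ) : Function.Injective (toLC I c α) := by
  have := hR.noetherian
  rw [injective_iff_map_eq_zero]
  intro x hx
  obtain ⟨β, h, h0⟩ := exists_map_eq_zero_of_toLC_eq_zero I c hx
  exact (injective_iff_map_eq_zero _).mp
    (ext_map_injective (hR.subsingleton_ext_of_lt (le_height_of_pow_le hI β))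
      (fun a ha x => smul_quotient_eq_zero ha x) (g := quotPowMap I h)
      (Ideal.Quotient.factor_surjective (Ideal.pow_le_pow_right h))) x h0

theorem exists_toLC_eq_of_smul {α : ℕ} {x : LC R I c (ModuleCat.of R R)}
    (hx : ∀ a ∈ I ^ α, a • x = 0) : ∃ ξ, toLC I c α ξ = x := by
  have := hR.noetherian
  obtain ⟨γ, hαγ, z, rfl⟩ : ∃ γ, α ≤ γ ∧ ∃ z, toLC I c γ z = x := by
    obtain ⟨β, z, hz⟩ := exists_toLC_eq I c x
    exact ⟨max α β, le_max_left _ _, _, (toLC_map I c (le_max_right _ _) z).trans hz⟩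
  have hz : ∀ a ∈ I ^ α, a • z = 0 := fun a ha => hR.toLC_injective hI γ (by
    rw [map_smul, hx a ha, map_zero])
  obtain ⟨ξ, hξ⟩ := (extToHom_bijective
    (hR.subsingleton_ext_of_lt (le_height_of_pow_le hI γ)) (N := R ⧸ I ^ α)
    (fun a ha y => smul_quotient_eq_zero (Ideal.pow_le_pow_right hαγ ha) y)).2 (eltMap z hz)
  have h1 := DFunLike.congr_fun hξ 1
  rw [eltMap_one, extToHom_apply] at h1
  refine ⟨ξ, (toLC_map I c hαγ ξ).symm.trans (congrArg _ (Eq.trans ?_ h1))⟩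
  congr 2
  exact quotient_hom_ext (by rw [eltMap_one]; rfl)

/-- `Ext^c(R/I^α, R)` is the submodule of `H^c_I(R)` of elements killed by `I^α`. -/
def extEquivTorsion (α : ℕ) : ExtR R c (R ⧸ I ^ α) ≃ₗ[R]
    Submodule.torsionBySet R (LC R I c (ModuleCat.of R R)) (I ^ α : Ideal R) :=
  LinearEquiv.ofBijective ((toLC I c α).codRestrict _ fun ξ => by
    rw [Submodule.mem_torsionBySet_iff]
    intro a
    rw [← map_smul, smul_ext_quotient_eq_zero c a.2, map_zero]) <| by
    refine ⟨fun x y h => hR.toLC_injective hI α (congrArg Subtype.val h), fun ⟨x, hx⟩ => ?_⟩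
    rw [Submodule.mem_torsionBySet_iff] at hx
    obtain ⟨ξ, hξ⟩ := hR.exists_toLC_eq_of_smul hI fun a ha => hx ⟨a, ha⟩
    exact ⟨ξ, Subtype.ext hξ⟩

omit hR hI [IsLocalRing R] in
theorem exists_pow_smul_eq_zero (x : LC R I c (ModuleCat.of R R)) :
    ∃ α : ℕ, ∀ a ∈ I ^ (α + 1), a • x = 0 := by
  obtain ⟨α, ξ, rfl⟩ := exists_toLC_eq I c x
  refine ⟨α, fun a ha => ?_⟩
  rw [← map_smul, smul_ext_quotient_eq_zero c (Ideal.pow_le_pow_right (Nat.le_succ α) ha), map_zero]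

theorem end_LC_mul_comm (f g : Module.End R (LC R I c (ModuleCat.of R R))) : f * g = g * f := by
  refine end_mul_comm_of_torsionBySet exists_pow_smul_eq_zero (fun α f g => ?_) f g
  let e := (hR.extEquivTorsion hI (α + 1)).symm.conjRingEquiv
  apply e.injective
  rw [map_mul, map_mul, hR.end_mul_comm (le_height_of_pow_le hI (α + 1))]

theorem isUnit_or_isUnit_one_sub_end_LC [IsAdicComplete (maximalIdeal R) R]
    (hconn : ∀ X : Set (PrimeSpectrum R),
      (∃ p, I ≤ p.asIdeal ∧ Order.height p = c ∧ p ∈ X) →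
      (∃ p, I ≤ p.asIdeal ∧ Order.height p = c ∧ p ∉ X) →
      ∃ p q P : PrimeSpectrum R, (I ≤ p.asIdeal ∧ Order.height p = c ∧ p ∈ X) ∧
        (I ≤ q.asIdeal ∧ Order.height q = c ∧ q ∉ X) ∧ p ≤ P ∧ q ≤ P ∧
        Order.height P = (c + 1 : ℕ)) (f : Module.End R (LC R I c (ModuleCat.of R R))) :
    IsUnit f ∨ IsUnit (1 - f) := by
  have := hR.noetherian
  refine isUnit_or_isUnit_one_sub_of_torsionBySet exists_pow_smul_eq_zero (fun α f => ?_) f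
  let e := (hR.extEquivTorsion hI (α + 1)).symm.conjRingEquiv
  have hpow : ∀ p : PrimeSpectrum R, I ^ (α + 1) ≤ p.asIdeal ↔ I ≤ p.asIdeal := fun p =>
    p.isPrime.pow_le_iff (Nat.succ_ne_zero α)
  have h := isUnit_or_isUnit_one_sub_of_finite (fun g hg => hR.idempotent_eq_zero_or_one
    (le_height_of_pow_le hI (α + 1)) (by simpa only [hpow] using hconn) hg) (e f)
  rw [← map_one e, ← map_sub] at h
  exact h.imp (isUnit_map_iff e f).mp (isUnit_map_iff e _).mp

theorem nontrivial_LC {p : PrimeSpectrum R} (hp : I ≤ p.asIdeal) (hpc : Order.height p = c) :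
    Nontrivial (LC R I c (ModuleCat.of R R)) := by
  have := hR.noetherian
  have hI1 := le_height_of_pow_le hI 1
  have hN : ∀ a ∈ I ^ 1, ∀ x : R ⧸ I ^ 1, a • x = 0 := fun a ha x => smul_quotient_eq_zero ha x
  have hnt : Nontrivial (ExtR R c (R ⧸ I ^ 1)) := by
    by_contra! hs
    have h1 := hR.lenAt_ext_eq_lenAt hpc (hR.eq_of_mem_support hI1 hpc hN)
    rw [lenAt_subsingleton] at h1
    exact lenAt_quotient_ne_zero p (by rwa [pow_one]) h1.symm
  exact (hR.toLC_injective hI 1).nontrivial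

theorem existsUnique_isMaximal_end_LC [IsAdicComplete (maximalIdeal R) R]
    (hne : ∃ p : PrimeSpectrum R, I ≤ p.asIdeal ∧ Order.height p = c)
    (hconn : ∀ X : Set (PrimeSpectrum R),
      (∃ p, I ≤ p.asIdeal ∧ Order.height p = c ∧ p ∈ X) →
      (∃ p, I ≤ p.asIdeal ∧ Order.height p = c ∧ p ∉ X) →
      ∃ p q P : PrimeSpectrum R, (I ≤ p.asIdeal ∧ Order.height p = c ∧ p ∈ X) ∧
        (I ≤ q.asIdeal ∧ Order.height q = c ∧ q ∉ X) ∧ p ≤ P ∧ q ≤ P ∧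
        Order.height P = (c + 1 : ℕ)) :
    ∃! M : Ideal (Module.End R (LC R I c (ModuleCat.of R R))), M.IsMaximal := by
  obtain ⟨p, hp, hpc⟩ := hne
  have := hR.nontrivial_LC hI hp hpc
  let _ : CommRing (Module.End R (LC R I c (ModuleCat.of R R))) :=
    { (inferInstance : Ring (Module.End R (LC R I c (ModuleCat.of R R)))) with
      mul_comm := hR.end_LC_mul_comm hI }
  have : IsLocalRing (Module.End R (LC R I c (ModuleCat.of R R))) :=
    IsLocalRing.of_isUnit_or_isUnit_one_sub_self (hR.isUnit_or_isUnit_one_sub_end_LC hI hconn)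
  exact IsLocalRing.maximal_ideal_unique _

end IsGorensteinOfDim

end Gluing

section Dimension

theorem ringKrullDim_quotient_prime {R : Type*} [CommRing R] (p : PrimeSpectrum R) :
    ringKrullDim (R ⧸ p.asIdeal) = Order.coheight p := by
  rw [ringKrullDim_quotient, Order.coheight_eq_krullDim_Ici]
  rfl

theorem ringKrullDim_quotient_anti {R : Type*} [CommRing R] {I J : Ideal R} (h : I ≤ J) :
    ringKrullDim (R ⧸ J) ≤ ringKrullDim (R ⧸ I) :=
  ringKrullDim_le_of_surjective (Ideal.Quotient.factor h) (Ideal.Quotient.factor_surjective h)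

theorem exists_coheight_eq_of_ringKrullDim_quotient {R : Type*} [CommRing R] {J : Ideal R} {k : ℕ}
    (h : ringKrullDim (R ⧸ J) = k) :
    ∃ p : PrimeSpectrum R, J ≤ p.asIdeal ∧ Order.coheight p = k := by
  rw [ringKrullDim_quotient] at h
  obtain ⟨l, hl⟩ := Order.le_krullDim_iff.mp h.ge
  refine ⟨l.head.1, l.head.2, le_antisymm ?_ ?_⟩
  · have h1 := ringKrullDim_quotient_anti (I := J) (J := l.head.1.asIdeal) l.head.2
    rw [ringKrullDim_quotient_prime, ringKrullDim_quotient J, h] at h1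
    exact_mod_cast h1
  · have h1 := Order.length_le_coheight_head (p := l.map Subtype.val (Subtype.strictMono_coe _))
    rwa [LTSeries.map_length, hl] at h1

theorem le_highestDimPart {R : Type u} [CommRing R] (I : Ideal R) : I ≤ highestDimPart R I :=
  Ideal.le_comap_map

theorem highestDimPart_le {R : Type u} [CommRing R] {I p : Ideal R} (hp : p ∈ I.minimalPrimes)
    (hdim : ringKrullDim (R ⧸ p) = ringKrullDim (R ⧸ I)) : highestDimPart R I ≤ p := by
  intro x hx
  obtain ⟨m, hm, hmx⟩ := (IsLocalization.algebraMap_mem_map_algebraMap_iff (asshCompl R I)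
    (Localization (asshCompl R I)) I x).mp hx
  exact (hp.1.1.mem_or_mem (hp.1.2 hmx)).resolve_left (hm p hp hdim)

theorem IsGorensteinLocalRing.isGorensteinOfDim {R : Type u} [CommRing R] [IsLocalRing R]
    (hGor : IsGorensteinLocalRing R) {n : ℕ} (hn : ringKrullDim R = n) :
    IsGorensteinOfDim R n := by
  obtain ⟨hN, m, hm, hsub, ⟨e⟩⟩ := hGor
  obtain rfl : m = n := by exact_mod_cast hm.symm.trans hn
  refine ⟨hN, ?_, fun i hi => ?_, ⟨(extMEquiv _ _).symm.trans e⟩⟩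
  · have h1 := IsLocalRing.maximalIdeal_height_eq_ringKrullDim (R := R)
    rw [hn] at h1
    exact (PrimeSpectrum.height_eq_orderHeight (closedPoint R)).symm.trans (by exact_mod_cast h1)
  · have := hsub i hi
    exact (extMEquiv i (R ⧸ maximalIdeal R)).symm.injective.subsingleton

theorem le_height_of_idealHeight_eq {R : Type u} [CommRing R] {I : Ideal R} {c : ℕ}
    (hc : idealHeight R I = c) (p : PrimeSpectrum R) (hp : I ≤ p.asIdeal) :
    c ≤ Order.height p :=
  hc.ge.trans (iInf_le (fun p : {p : PrimeSpectrum R // I ≤ p.asIdeal} =>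
    Order.height (p : PrimeSpectrum R)) ⟨p, hp⟩)

theorem exists_height_eq_of_idealHeight_eq {R : Type u} [CommRing R] {I : Ideal R} {c : ℕ}
    (hc : idealHeight R I = c) : ∃ p : PrimeSpectrum R, I ≤ p.asIdeal ∧ Order.height p = c := by
  rw [idealHeight] at hc
  have : Nonempty {p : PrimeSpectrum R // I ≤ p.asIdeal} := by
    by_contra! h
    rw [iInf_of_empty] at hc
    exact ENat.top_ne_natCast c hc
  obtain ⟨⟨p, hp⟩, h⟩ := ciInf_mem fun p : {p : PrimeSpectrum R // I ≤ p.asIdeal} =>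
    Order.height (p : PrimeSpectrum R)
  exact ⟨p, hp, h.trans hc⟩

namespace IsGorensteinOfDim

variable {R : Type u} [CommRing R] [IsLocalRing R] {n : ℕ} (hR : IsGorensteinOfDim R n)
  {I : Ideal R} {c d : ℕ}

include hR

theorem coheight_eq_iff_height_eq {a b : ℕ} (h : a + b = n) (p : PrimeSpectrum R) :
    Order.coheight p = b ↔ Order.height p = a := by
  have h1 := hR.height_add_coheight p
  obtain ⟨k, hk⟩ := ENat.ne_top_iff_exists.mp (hR.height_ne_top p)
  obtain ⟨l, hl⟩ := ENat.ne_top_iff_exists.mp (hR.coheight_ne_top p)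
  rw [← hk, ← hl] at h1 ⊢
  norm_cast at h1 ⊢
  omega

variable (hc : idealHeight R I = c) (hd : ringKrullDim (R ⧸ I) = d)

include hc hd

theorem add_eq_of_idealHeight : c + d = n := by
  obtain ⟨p, hp, hpc⟩ := exists_height_eq_of_idealHeight_eq hc
  obtain ⟨q, hq, hqd⟩ := exists_coheight_eq_of_ringKrullDim_quotient hd
  have h1 := hR.height_add_coheight p
  have h2 := hR.height_add_coheight q
  have h3 := ringKrullDim_quotient_anti hp
  have h4 := le_height_of_idealHeight_eq hc q hq
  rw [ringKrullDim_quotient_prime, hd] at h3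
  obtain ⟨k, hk⟩ := ENat.ne_top_iff_exists.mp (hR.height_ne_top q)
  obtain ⟨l, hl⟩ := ENat.ne_top_iff_exists.mp (hR.coheight_ne_top p)
  rw [← hk] at h2 h4
  rw [← hl] at h1 h3
  rw [hpc] at h1
  rw [hqd] at h2
  norm_cast at h1 h2 h3 h4
  omega

theorem mem_minimalPrimes_highestDimPart {p : PrimeSpectrum R} (hp : I ≤ p.asIdeal)
    (hpc : Order.height p = c) : p.asIdeal ∈ (highestDimPart R I).minimalPrimes ∧
      ringKrullDim (R ⧸ p.asIdeal) = d ∧ ringKrullDim (R ⧸ highestDimPart R I) = d := by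
  have hpd : ringKrullDim (R ⧸ p.asIdeal) = d := by
    rw [ringKrullDim_quotient_prime,
      (hR.coheight_eq_iff_height_eq (hR.add_eq_of_idealHeight hc hd) p).mpr hpc]
    rfl
  have hmin : ∀ q : Ideal R, q.IsPrime → I ≤ q → q ≤ p.asIdeal → p.asIdeal ≤ q :=
    fun q hq hIq hqp => (hR.eq_of_le_of_height_le (p := ⟨q, hq⟩) (q := p) hqp
      (hpc.le.trans (le_height_of_idealHeight_eq hc ⟨q, hq⟩ hIq))).ge
  have hle : highestDimPart R I ≤ p.asIdeal :=
    highestDimPart_le ⟨⟨p.isPrime, hp⟩, fun q hq => hmin q hq.1 hq.2⟩ (hpd.trans hd.symm)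
  refine ⟨⟨⟨p.isPrime, hle⟩, fun q hq => hmin q hq.1 ((le_highestDimPart I).trans hq.2)⟩, hpd,
    le_antisymm (hd ▸ ringKrullDim_quotient_anti (le_highestDimPart I)) ?_⟩
  rw [← hpd]
  exact ringKrullDim_quotient_anti hle

theorem exists_height_succ_of_connectedInCodimensionOne
    (hconn : ConnectedInCodimensionOne R (highestDimPart R I)) (X : Set (PrimeSpectrum R))
    (hX : ∃ p, I ≤ p.asIdeal ∧ Order.height p = c ∧ p ∈ X)
    (hX' : ∃ p, I ≤ p.asIdeal ∧ Order.height p = c ∧ p ∉ X) :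
    ∃ p q P : PrimeSpectrum R, (I ≤ p.asIdeal ∧ Order.height p = c ∧ p ∈ X) ∧
      (I ≤ q.asIdeal ∧ Order.height q = c ∧ q ∉ X) ∧ p ≤ P ∧ q ≤ P ∧
      Order.height P = (c + 1 : ℕ) := by
  obtain ⟨p₀, hp₀, hp₀c, hp₀X⟩ := hX
  obtain ⟨q₀, hq₀, hq₀c, hq₀X⟩ := hX'
  have hcd := hR.add_eq_of_idealHeight hc hd
  obtain ⟨hp₀min, hp₀d, hJd⟩ := hR.mem_minimalPrimes_highestDimPart hc hd hp₀ hp₀c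
  obtain ⟨hq₀min, hq₀d, -⟩ := hR.mem_minimalPrimes_highestDimPart hc hd hq₀ hq₀c
  let V := {p : Ideal R // p ∈ (highestDimPart R I).minimalPrimes ∧
    ringKrullDim (R ⧸ p) = ringKrullDim (R ⧸ highestDimPart R I)}
  let pt : V → PrimeSpectrum R := fun v => ⟨v.1, v.2.1.1.1⟩
  have hpt : ∀ v : V, I ≤ (pt v).asIdeal ∧ Order.height (pt v) = c := fun v => by
    refine ⟨(le_highestDimPart I).trans v.2.1.1.2,
      (hR.coheight_eq_iff_height_eq hcd (pt v)).mp ?_⟩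
    have h1 := ringKrullDim_quotient_prime (pt v)
    rw [show ringKrullDim (R ⧸ (pt v).asIdeal) = d from v.2.2.trans hJd] at h1
    exact_mod_cast h1.symm
  obtain ⟨w⟩ := hconn.preconnected ⟨p₀.asIdeal, hp₀min, hp₀d.trans hJd.symm⟩
    ⟨q₀.asIdeal, hq₀min, hq₀d.trans hJd.symm⟩
  obtain ⟨⟨⟨u, v⟩, huv⟩, -, hu, hv⟩ := w.exists_boundary_dart (pt ⁻¹' X) hp₀X hq₀X
  have hdim : ringKrullDim (R ⧸ (u.1 ⊔ v.1)) + 1 = d := by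
    obtain ⟨-, h | h⟩ := (SimpleGraph.fromRel_adj _ _ _).mp huv
    · exact h.trans hJd
    · rw [sup_comm]
      exact h.trans hJd
  obtain ⟨m, hm, rfl⟩ : ∃ m : ℕ, ringKrullDim (R ⧸ (u.1 ⊔ v.1)) = m ∧ d = m + 1 := by
    generalize ringKrullDim (R ⧸ (u.1 ⊔ v.1)) = x at hdim ⊢
    induction x with
    | bot => simp at hdim
    | coe x =>
      induction x with
      | top =>
        rw [← WithBot.coe_one, ← WithBot.coe_add] at hdim
        exact absurd hdim (by exact_mod_cast ENat.top_ne_natCast d)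
      | coe m => exact ⟨m, rfl, by exact_mod_cast hdim.symm⟩
  obtain ⟨P, hP, hPm⟩ := exists_coheight_eq_of_ringKrullDim_quotient hm
  exact ⟨pt u, pt v, P, ⟨(hpt u).1, (hpt u).2, hu⟩, ⟨(hpt v).1, (hpt v).2, hv⟩,
    le_sup_left.trans hP, le_sup_right.trans hP,
    (hR.coheight_eq_iff_height_eq (by omega) P).mp hPm⟩

end IsGorensteinOfDim

end Dimension

/-- Let `(R, 𝔪)` be a complete `n`-dimensional Gorenstein local ring
and `I ⊆ R` an ideal with `c = height I` and `d = dim R/I`.  If `V(I_d)` is connected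
in codimension one, then `B = Hom_R(H^c_I(R), H^c_I(R))` is a quasi-local ring:
a commutative ring with a unique maximal ideal. -/
theorem endo_ring_of_localCohomology_quasiLocal_of_connectedInCodimensionOne
    (R : Type u) [CommRing R] [IsLocalRing R]
    (hGor : IsGorensteinLocalRing R) (hComplete : IsAdicComplete (maximalIdeal R) R)
    (n : ℕ) (hn : ringKrullDim R = n)
    (I : Ideal R) (c d : ℕ) (hc : idealHeight R I = c)
    (hd : ringKrullDim (R ⧸ I) = d)
    (hconn : ConnectedInCodimensionOne R (highestDimPart R I)) :
    (∀ f g : Module.End R ↥(LC R I c (ModuleCat.of R R)), f * g = g * f) ∧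
    ∃! M : Ideal (Module.End R ↥(LC R I c (ModuleCat.of R R))), M.IsMaximal := by
  have hR := hGor.isGorensteinOfDim hn
  exact ⟨hR.end_LC_mul_comm (le_height_of_idealHeight_eq hc),
    hR.existsUnique_isMaximal_end_LC (le_height_of_idealHeight_eq hc)
      (exists_height_eq_of_idealHeight_eq hc)
      (hR.exists_height_succ_of_connectedInCodimensionOne hc hd hconn)⟩
end
end

section
/- Let (R, m) be an n-dimensional Gorenstein local ring and M a finitely generated R-module with d = dim M and c = n − d. Then there are canonical isomorphisms K(K(M) ⊗_R M) ≅ Hom_R(K(M), K(M)) ≅ Hom_R(M, K(K(M))), where K(N) = Ext_R^{n − dim N}(N, R) denotes the canonical module of a finitely generated module N. -/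
open CategoryTheory CategoryTheory.Limits Opposite IsLocalRing

noncomputable section

universe u

section Comparison

variable {R : Type u} [CommRing R] {X : ModuleCat.{u} R} (P : ProjectiveResolution X)

lemma CategoryTheory.ProjectiveResolution.smul_extMk (r : R) {Y : ModuleCat.{u} R} {n : ℕ}
    (f : P.complex.X n ⟶ Y) (hf : P.complex.d (n + 1) n ≫ f = 0) :
    r • P.extMk f (n + 1) rfl hf = P.extMk (r • f) (n + 1) rfl (by simp [hf]) := by
  rw [Abelian.Ext.smul_eq_comp_mk₀, P.extMk_comp_mk₀]
  congr 1

/-- A degree zero cocycle represents zero in `Ext` only if it is zero. -/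
lemma CategoryTheory.ProjectiveResolution.extMk_degree_zero_eq_zero_iff_s13 {Y : ModuleCat.{u} R}
    (f : P.complex.X 0 ⟶ Y) (hf : P.complex.d 1 0 ≫ f = 0) :
    P.extMk f 1 rfl hf = 0 ↔ f = 0 := by
  refine ⟨fun h ↦ ?_, fun h ↦ by subst h; simp⟩
  rw [← P.extEquivCohomologyClass.apply_eq_iff_eq,
    P.extEquivCohomologyClass_extMk, P.extEquivCohomologyClass_zero,
    CochainComplex.HomComplex.CohomologyClass.mk_eq_zero_iff,
    CochainComplex.HomComplex.Cocycle.toSingleMk_mem_coboundaries_iff _ _ _ _ _ 1 (by simp)] at h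
  obtain ⟨g, hg⟩ := h
  have hd : P.cochainComplex.d (-(0 : ℕ)) 1 = 0 := by
    apply IsZero.eq_of_tgt
    exact P.cochainComplex.isZero_of_isStrictlyLE 0 1 (by simp)
  rw [hd, zero_comp] at hg
  rw [← cancel_epi (P.cochainComplexXIso (-(0 : ℕ)) 0 rfl).hom, ← hg, comp_zero]

/-- The class in `Ext` of a cocycle of the complex `Hom(P, Y)`. -/
def CategoryTheory.ProjectiveResolution.cocycleToExt (Y : ModuleCat.{u} R) (n : ℕ) :
    LinearMap.ker (Linear.leftComp R Y (P.complex.d (n + 1) n)) →ₗ[R] Abelian.Ext X Y n where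
  toFun f := P.extMk f.1 (n + 1) rfl f.2
  map_add' _ _ := (P.add_extMk _ _ _ _ _ _).symm
  map_smul' r _ := (P.smul_extMk r _ _).symm

/-- The two definitions of `Ext` modules agree. -/
lemma nonempty_extM_linearEquiv_ext (X Y : ModuleCat.{u} R) (n : ℕ) :
    Nonempty (ExtM R n X Y ≃ₗ[R] Abelian.Ext X Y n) := by
  let P := ProjectiveResolution.of X
  let K := P.complex.linearYonedaObj R Y
  have hn : (ComplexShape.up ℕ).next n = n + 1 := CochainComplex.next ℕ n
  obtain ⟨p, hp⟩ : ∃ p, (ComplexShape.up ℕ).prev n = p := ⟨_, rfl⟩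
  let S := K.sc' p n (n + 1)
  let e : ExtM R n X Y ≅ S.moduleCatLeftHomologyData.H :=
    P.isoExt n Y ≪≫ K.homologyIsoSc' p n _ hp hn ≪≫ S.moduleCatHomologyIso
  let φ : LinearMap.ker S.g.hom →ₗ[R] Abelian.Ext X Y n := P.cocycleToExt Y n
  have hsurj : Function.Surjective φ := fun α ↦ by
    obtain ⟨f, hf, h⟩ := P.extMk_surjective α (n + 1) rfl
    exact ⟨⟨f, hf⟩, h⟩
  have hker : LinearMap.range S.moduleCatToCycles = LinearMap.ker φ := by
    ext ⟨f, hf⟩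
    have key : φ ⟨f, hf⟩ = 0 ↔ ∃ g, S.f.hom g = f := by
      rcases n with _ | n
      · refine (P.extMk_degree_zero_eq_zero_iff_s13 f hf).trans ?_
        have : S.f = 0 := K.shape p 0 (by simp)
        rw [this]
        exact ⟨fun h ↦ ⟨0, h.symm⟩, fun ⟨_, h⟩ ↦ h.symm⟩
      · obtain rfl : n = p := by rw [← hp, CochainComplex.prev_nat_succ]
        exact P.extMk_eq_zero_iff f (n + 2) rfl hf n rfl
    rw [LinearMap.mem_ker, key]
    simp only [LinearMap.mem_range, Subtype.ext_iff]
    rfl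
  exact ⟨e.toLinearEquiv ≪≫ₗ Submodule.quotEquivOfEq _ _ hker ≪≫ₗ φ.quotKerEquivOfSurjective hsurj⟩

end Comparison

section Grade

variable {R : Type u} [CommRing R]

lemma ext_comp_smulShortComplex_f {N A : ModuleCat.{u} R} (x : R) {i : ℕ}
    (y : Abelian.Ext N A i) :
    y.comp (Abelian.Ext.mk₀ (A.smulShortComplex x).f) (add_zero i) = x • y := by
  exact (Abelian.Ext.smul_eq_comp_mk₀ y x).symm

lemma smulShortComplex_f_comp_ext {N A : ModuleCat.{u} R} (x : R) {i : ℕ}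
    (y : Abelian.Ext N A i) :
    (Abelian.Ext.mk₀ (N.smulShortComplex x).f).comp y (zero_add i) = x • y := by
  have h : (Abelian.Ext.mk₀ (x • 𝟙 N)).comp y (zero_add i) = x • y := by
    simp [Abelian.Ext.mk₀_smul]
  exact h

lemma smul_ext_eq_zero_of_mem_annihilator {N A : ModuleCat.{u} R} {x : R}
    (hx : x ∈ Module.annihilator R N) {i : ℕ} (y : Abelian.Ext N A i) : x • y = 0 := by
  have h : x • 𝟙 N = 0 := by
    simp [← ModuleCat.lsmul_eq_smul_id, Module.mem_annihilator_iff_lsmul_eq_zero.mp hx]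
  have : x • y = (Abelian.Ext.mk₀ (x • 𝟙 N)).comp y (zero_add i) :=
    (smulShortComplex_f_comp_ext x y).symm
  simp [this, h]

lemma subsingleton_ext_X₃ (N : ModuleCat.{u} R) {S : ShortComplex (ModuleCat.{u} R)}
    (hS : S.ShortExact) {i : ℕ} (h₂ : Subsingleton (Abelian.Ext N S.X₂ i))
    (h₁ : Subsingleton (Abelian.Ext N S.X₁ (i + 1))) : Subsingleton (Abelian.Ext N S.X₃ i) := by
  refine subsingleton_of_forall_eq 0 fun y ↦ ?_
  obtain ⟨z, rfl⟩ := Abelian.Ext.covariant_sequence_exact₃ N hS y rfl (Subsingleton.elim _ _)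
  rw [Subsingleton.elim z 0, Abelian.Ext.zero_comp]

lemma postcomp_extClass_injective (N : ModuleCat.{u} R) {S : ShortComplex (ModuleCat.{u} R)}
    (hS : S.ShortExact) {i : ℕ} (h₂ : Subsingleton (Abelian.Ext N S.X₂ i)) :
    Function.Injective (hS.extClass.postcompOfLinear R N (rfl : i + 1 = _)) := by
  rw [← LinearMap.ker_eq_bot, LinearMap.ker_eq_bot']
  intro y hy
  obtain ⟨z, rfl⟩ := Abelian.Ext.covariant_sequence_exact₃ N hS y rfl hy
  rw [Subsingleton.elim z 0, Abelian.Ext.zero_comp]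

lemma subsingleton_ext_X₂ {S : ShortComplex (ModuleCat.{u} R)} (hS : S.ShortExact)
    (A : ModuleCat.{u} R) {i : ℕ} (h₁ : Subsingleton (Abelian.Ext S.X₁ A i))
    (h₃ : Subsingleton (Abelian.Ext S.X₃ A i)) : Subsingleton (Abelian.Ext S.X₂ A i) := by
  refine subsingleton_of_forall_eq 0 fun y ↦ ?_
  obtain ⟨z, rfl⟩ := Abelian.Ext.contravariant_sequence_exact₂ hS A y (Subsingleton.elim _ _)
  rw [Subsingleton.elim z 0, Abelian.Ext.comp_zero]

/-- If `Ext^i(N, A)` vanishes for `i < c`, then on modules killed by the annihilator of `N`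
the functor `Ext^c(-, A)` is of the form `Hom(-, B)`. -/
lemma exists_ext_linearEquiv_hom [IsNoetherianRing R] (N : ModuleCat.{u} R) [Module.Finite R N]
    (c : ℕ) (A : ModuleCat.{u} R) [Module.Finite R A]
    (h : ∀ i < c, Subsingleton (Abelian.Ext N A i)) :
    ∃ B : ModuleCat.{u} R, ∀ L : ModuleCat.{u} R,
      Module.annihilator R N ≤ Module.annihilator R L →
        (∀ i < c, Subsingleton (Abelian.Ext L A i)) ∧
          Nonempty (Abelian.Ext L A c ≃ₗ[R] (L →ₗ[R] B)) := by
  induction c generalizing A with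
  | zero =>
    exact ⟨A, fun L _ ↦ ⟨by simp,
      ⟨Abelian.Ext.linearEquiv₀.trans ModuleCat.homLinearEquiv⟩⟩⟩
  | succ c ih =>
    have h0 : Subsingleton (N →ₗ[R] A) :=
      (Abelian.Ext.addEquiv₀.trans ModuleCat.homAddEquiv).symm.toEquiv.subsingleton_congr.mpr
        (h 0 c.succ_pos)
    obtain ⟨x, hxN, hx⟩ := IsSMulRegular.subsingleton_linearMap_iff.mp h0
    have hS := hx.smulShortComplex_shortExact
    have h' : ∀ i < c, Subsingleton (Abelian.Ext N (ModuleCat.of R (QuotSMulTop x A)) i) :=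
      fun i hi ↦ subsingleton_ext_X₃ N hS (h i (by omega)) (h (i + 1) (by omega))
    obtain ⟨B, hB⟩ := ih (ModuleCat.of R (QuotSMulTop x A)) h'
    refine ⟨B, fun L hL ↦ ?_⟩
    obtain ⟨hL0, ⟨e⟩⟩ := hB L hL
    have surj (i : ℕ) : Function.Surjective (hS.extClass.postcompOfLinear R L (rfl : i + 1 = _)) :=
      fun y ↦ Abelian.Ext.covariant_sequence_exact₁ L hS y
        ((ext_comp_smulShortComplex_f x y).trans
          (smul_ext_eq_zero_of_mem_annihilator (hL hxN) y)) rfl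
    have vanish : ∀ i < c + 1, Subsingleton (Abelian.Ext L A i) := by
      rintro (_ | i) hi
      · have := IsSMulRegular.linearMap_subsingleton_of_mem_annihilator hx (hL hxN)
        exact (Abelian.Ext.addEquiv₀.trans ModuleCat.homAddEquiv).toEquiv.subsingleton
      · have : Subsingleton (Abelian.Ext L (A.smulShortComplex x).X₃ i) := hL0 i (by omega)
        exact (surj i).subsingleton
    exact ⟨vanish, ⟨(LinearEquiv.ofBijective _
      ⟨postcomp_extClass_injective L hS (vanish c (by omega)), surj c⟩).symm.trans e⟩⟩

lemma subsingleton_ext_of_linearEquiv {N L : Type u} [AddCommGroup N] [Module R N]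
    [AddCommGroup L] [Module R L] (e : N ≃ₗ[R] L) (A : ModuleCat.{u} R) (i : ℕ)
    (h : Subsingleton (Abelian.Ext (ModuleCat.of R L) A i)) :
    Subsingleton (Abelian.Ext (ModuleCat.of R N) A i) := by
  refine subsingleton_of_forall_eq 0 fun y ↦ ?_
  have : y = (Abelian.Ext.mk₀ e.toModuleIso.hom).comp
      ((Abelian.Ext.mk₀ e.toModuleIso.inv).comp y (zero_add i)) (zero_add i) := by
    rw [Abelian.Ext.mk₀_comp_mk₀_assoc, Iso.hom_inv_id, Abelian.Ext.mk₀_id_comp]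
  rw [this, Subsingleton.elim ((Abelian.Ext.mk₀ e.toModuleIso.inv).comp y (zero_add i)) 0,
    Abelian.Ext.comp_zero]

end Grade

section Vanishing

variable {R : Type u} [CommRing R] [IsNoetherianRing R] [IsLocalRing R]

open Pointwise

/-- If `x` lies in the maximal ideal but not in the prime `p`, and `Ext^(i+1)` of
`(R ⧸ p) ⧸ x (R ⧸ p)` vanishes, then so does `Ext^i` of `R ⧸ p`. -/
lemma subsingleton_ext_quotient_prime (A : ModuleCat.{u} R) [Module.Finite R A] (p : Ideal R)
    [p.IsPrime] {x : R} (hxp : x ∉ p) (hx : x ∈ maximalIdeal R) (i : ℕ)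
    (h : Subsingleton (Abelian.Ext (ModuleCat.of R (QuotSMulTop x (R ⧸ p))) A (i + 1))) :
    Subsingleton (Abelian.Ext (ModuleCat.of R (R ⧸ p)) A i) := by
  have hreg : IsSMulRegular (ModuleCat.of R (R ⧸ p)) x := by
    refine (isSMulRegular_iff_right_eq_zero_of_smul).mpr fun y hy ↦ ?_
    have hy' : Ideal.Quotient.mk p x * y = 0 := by
      simpa [Algebra.smul_def] using hy
    exact (mul_eq_zero.mp hy').resolve_left (mt Ideal.Quotient.eq_zero_iff_mem.mp hxp)
  have hS := hreg.smulShortComplex_shortExact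
  have htop : (⊤ : Submodule R (Abelian.Ext (ModuleCat.of R (R ⧸ p)) A i)) ≤
      maximalIdeal R • ⊤ := by
    intro y _
    obtain ⟨z, rfl⟩ := Abelian.Ext.contravariant_sequence_exact₁ hS A y (add_comm 1 i)
      (Subsingleton.elim (α := Abelian.Ext (ModuleCat.of R (QuotSMulTop x (R ⧸ p))) A (i + 1)) _ _)
    have := smulShortComplex_f_comp_ext (N := ModuleCat.of R (R ⧸ p)) x z
    refine this ▸ ?_
    exact Submodule.smul_mem_smul hx trivial
  have := Submodule.eq_bot_of_le_smul_of_le_jacobson_bot (maximalIdeal R) ⊤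
    Module.Finite.fg_top htop (maximalIdeal_le_jacobson _)
  exact Submodule.subsingleton_iff R |>.mp (subsingleton_of_bot_eq_top this.symm)

/-- Ischebeck's vanishing: if `Ext^i(k, A) = 0` for `i < n`, then `Ext^i(N, A) = 0` for
`i < n - dim N`. -/
lemma subsingleton_ext_of_add_dim_lt (A : ModuleCat.{u} R) [Module.Finite R A] (n : ℕ)
    (hk : ∀ i < n, Subsingleton (Abelian.Ext (ModuleCat.of R (R ⧸ maximalIdeal R)) A i))
    (d : ℕ) {N : Type u} [AddCommGroup N] [Module R N] [hN : Module.Finite R N]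
    (hd : ringKrullDim (R ⧸ Module.annihilator R N) ≤ d) (i : ℕ) (hi : i + d < n) :
    Subsingleton (Abelian.Ext (ModuleCat.of R N) A i) := by
  induction d using Nat.strong_induction_on generalizing N i with | _ d ih =>
  induction hN using IsNoetherianRing.induction_on_isQuotientEquivQuotientPrime R
    generalizing i with
  | subsingleton N =>
    have hzero : 𝟙 (ModuleCat.of R N) = 0 := (ModuleCat.isZero_of_subsingleton _).eq_of_src _ _
    refine subsingleton_of_forall_eq 0 fun y ↦ ?_
    rw [← y.mk₀_id_comp, hzero, Abelian.Ext.mk₀_zero, Abelian.Ext.zero_comp]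
  | quotient N p e =>
    have := p.2
    refine subsingleton_ext_of_linearEquiv e A i ?_
    by_cases hp : p.1 = maximalIdeal R
    · rw [hp]
      exact hk i (by omega)
    have hpm : p.1 ≤ maximalIdeal R := le_maximalIdeal p.2.ne_top
    obtain ⟨x, hx, hxp⟩ := SetLike.exists_of_lt (lt_of_le_of_ne hpm hp)
    have hdp : ringKrullDim (R ⧸ p.1) ≤ d := by
      rwa [e.annihilator_eq, Ideal.annihilator_quotient] at hd
    have hdrop (J : Ideal R) (hpJ : p.1 ≤ J) (hxJ : x ∈ J) :
        ringKrullDim (R ⧸ J) + 1 ≤ d :=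
      (ringKrullDim_succ_le_of_surjective (Ideal.Quotient.factor hpJ)
        (Ideal.Quotient.factor_surjective hpJ) (r := Ideal.Quotient.mk p.1 x)
        (mem_nonZeroDivisors_of_ne_zero (mt Ideal.Quotient.eq_zero_iff_mem.mp hxp))
        (by simpa [Ideal.Quotient.eq_zero_iff_mem] using hxJ)).trans hdp
    rcases d with _ | d
    · have h1 := hdrop (maximalIdeal R) hpm hx
      have h2 : 0 ≤ ringKrullDim (R ⧸ maximalIdeal R) := ringKrullDim_nonneg_of_nontrivial
      have h3 : (0 : WithBot ℕ∞) + 1 ≤ 0 := (add_le_add_left h2 1).trans h1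
      exact absurd h3 (by decide)
    refine subsingleton_ext_quotient_prime A p.1 hxp hx i ?_
    refine ih d d.lt_succ_self ?_ (i + 1) (by omega)
    have h1 := hdrop (Module.annihilator R (QuotSMulTop x (R ⧸ p.1))) ?_ ?_
    · exact ENat.WithBot.add_le_add_one_right_iff.mp (by simpa using h1)
    · exact (Ideal.annihilator_quotient (I := p.1)).ge.trans
        (LinearMap.annihilator_le_of_surjective (x • (⊤ : Submodule R (R ⧸ p.1))).mkQ
          (Submodule.mkQ_surjective _))
    · refine Module.mem_annihilator.mpr fun y ↦ ?_
      obtain ⟨y, rfl⟩ := Submodule.mkQ_surjective _ y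
      rw [← map_smul, Submodule.mkQ_apply, Submodule.Quotient.mk_eq_zero]
      exact Submodule.smul_mem_pointwise_smul _ _ _ trivial
  | exact N₁ N₂ N₃ f g hf hg hfg h₁ h₃ =>
    have mono (J : Ideal R) (hJ : Module.annihilator R N₂ ≤ J) : ringKrullDim (R ⧸ J) ≤ d :=
      (ringKrullDim_le_of_surjective (Ideal.Quotient.factor hJ)
        (Ideal.Quotient.factor_surjective hJ)).trans hd
    have this₁ := h₁ (mono _ (f.annihilator_le_of_injective hf)) i hi
    have this₃ := h₃ (mono _ (g.annihilator_le_of_surjective hg)) i hi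
    let S := ShortComplex.moduleCatMk f g hfg.linearMap_comp_eq_zero
    have hS : S.ShortExact :=
      { exact := (ShortComplex.ShortExact.moduleCat_exact_iff_function_exact S).mpr hfg
        mono_f := (ModuleCat.mono_iff_injective _).mpr hf
        epi_g := (ModuleCat.epi_iff_surjective _).mpr hg }
    exact subsingleton_ext_X₂ hS A this₁ this₃

end Vanishing

/-- Let `(R, 𝔪)` be an `n`-dimensional Gorenstein local ring and
`M` a finitely generated `R`-module with `d = dim M` and `c = n - d`.  With
`K(N) = Ext^{n - dim N}_R(N, R)` the canonical module, there are canonical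
isomorphisms `K(K(M) ⊗_R M) ≅ Hom_R(K(M), K(M)) ≅ Hom_R(M, K(K(M)))`. -/
theorem canonical_module_endomorphism_isos
    (R : Type u) [CommRing R] [IsLocalRing R]
    (hGor : IsGorensteinLocalRing R) (n : ℕ) (hn : ringKrullDim R = n)
    (M : Type u) [AddCommGroup M] [Module R M] [Module.Finite R M]
    (d c : ℕ) (hd : ringKrullDim (R ⧸ Module.annihilator R M) = d)
    (hc : c + d = n) :
    Nonempty (↥(ExtM R c (ModuleCat.of R
        (TensorProduct R ↥(ExtM R c (ModuleCat.of R M) (ModuleCat.of R R)) M))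
        (ModuleCat.of R R)) ≃ₗ[R]
      (↥(ExtM R c (ModuleCat.of R M) (ModuleCat.of R R)) →ₗ[R]
        ↥(ExtM R c (ModuleCat.of R M) (ModuleCat.of R R)))) ∧
    Nonempty ((↥(ExtM R c (ModuleCat.of R M) (ModuleCat.of R R)) →ₗ[R]
        ↥(ExtM R c (ModuleCat.of R M) (ModuleCat.of R R))) ≃ₗ[R]
      (M →ₗ[R] ↥(ExtM R c
        (ExtM R c (ModuleCat.of R M) (ModuleCat.of R R)) (ModuleCat.of R R)))) := by
  have hR : IsNoetherianRing R := hGor.1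
  obtain ⟨-, n', hn', hk, -⟩ := hGor
  obtain rfl : n = n' := by exact_mod_cast hn.symm.trans hn'
  have hk' (i : ℕ) (hi : i < n) : Subsingleton
      (Abelian.Ext (ModuleCat.of R (R ⧸ maximalIdeal R)) (ModuleCat.of R R) i) := by
    have := hk i hi.ne
    obtain ⟨e⟩ := nonempty_extM_linearEquiv_ext (ModuleCat.of R (R ⧸ maximalIdeal R))
      (ModuleCat.of R R) i
    exact e.symm.toEquiv.subsingleton
  obtain ⟨B, hB⟩ := exists_ext_linearEquiv_hom (ModuleCat.of R M) c (ModuleCat.of R R)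
    fun i hi ↦ subsingleton_ext_of_add_dim_lt (ModuleCat.of R R) n hk' d hd.le i (by omega)
  have hom (L : Type u) [AddCommGroup L] [Module R L]
      (hL : Module.annihilator R M ≤ Module.annihilator R L) :
      Nonempty (ExtM R c (ModuleCat.of R L) (ModuleCat.of R R) ≃ₗ[R] (L →ₗ[R] B)) := by
    obtain ⟨e⟩ := nonempty_extM_linearEquiv_ext (ModuleCat.of R L) (ModuleCat.of R R) c
    exact (hB (ModuleCat.of R L) hL).2.map e.trans
  obtain ⟨eM⟩ := hom M le_rfl
  generalize ExtM R c (ModuleCat.of R M) (ModuleCat.of R R) = K at eM ⊢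
  have hK : Module.annihilator R M ≤ Module.annihilator R K := fun r hr ↦
    Module.mem_annihilator.mpr fun k ↦ eM.injective <| LinearMap.ext fun m ↦ by
      rw [map_smul, LinearMap.smul_apply, ← map_smul, Module.mem_annihilator.mp hr m, map_zero,
        map_zero, LinearMap.zero_apply]
  have hKM : Module.annihilator R M ≤ Module.annihilator R (TensorProduct R K M) := fun r hr ↦ by
    refine Module.mem_annihilator.mpr fun t ↦ ?_
    induction t with
    | zero => simp
    | tmul k m =>
      rw [← TensorProduct.tmul_smul, Module.mem_annihilator.mp hr, TensorProduct.tmul_zero]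
    | add s t hs ht => rw [smul_add, hs, ht, add_zero]
  obtain ⟨eK⟩ := hom K hK
  obtain ⟨eKM⟩ := hom (TensorProduct R K M) hKM
  have eHom : (K →ₗ[R] K) ≃ₗ[R] (K →ₗ[R] M →ₗ[R] B) := eM.congrRight
  exact ⟨⟨eKM ≪≫ₗ (TensorProduct.lift.equiv (.id R) K M B).symm ≪≫ₗ eHom.symm⟩,
    ⟨eHom ≪≫ₗ LinearMap.lflip ≪≫ₗ eK.symm.congrRight⟩⟩
end
end
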